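/- For every α ∈ (1,2) and every real s with −1 − 1/α < s < 1 − 1/α and s ≠ −1/α, one has ∫₀^∞ x^s · h_α(x) dx = Γ(1−αs)·sin(π(α−1)(s+1/α)) / (Γ(1−s)·sin(π(s+1/α))). -/

import Mathlib

open Real MeasureTheory Set

/-- The density `h_α` of the first hitting time of level 1 by a normalized
spectrally positive `α`-stable Lévy process. -/
noncomputable def hittingDensity (α x : ℝ) : ℝ :=
  (∑' n : ℕ, (-α) * x ^ (1 / α - ((n : ℝ) + 1) - 1) /
      (Real.Gamma (α * ((n : ℝ) + 1)) * Real.Gamma (1 / α - ((n : ℝ) + 1))))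
  + ∑' n : ℕ, x ^ (-((n : ℝ) + 1) / α - 1) /
      (Real.Gamma (-((n : ℝ) + 1) / α) * (Nat.factorial (n + 1) : ℝ))

open Filter Topology FourierTransform

/-- Shifting a horizontal line of integration inside a strip of holomorphy. -/
theorem integral_horizontal_line_eq {f : ℂ → ℂ} {a b : ℝ} {B : ℝ → ℝ}
    (hc : ContinuousOn f {w | w.im ∈ uIcc a b})
    (hd : DifferentiableOn ℂ f {w | w.im ∈ Ioo (min a b) (max a b)})
    (hB : Integrable B) (hbot : Tendsto B atBot (𝓝 0)) (htop : Tendsto B atTop (𝓝 0))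
    (hf : ∀ w : ℂ, w.im ∈ uIcc a b → ‖f w‖ ≤ B w.re) :
    ∫ x : ℝ, f (x + a * Complex.I) = ∫ x : ℝ, f (x + b * Complex.I) := by
  have hint : ∀ c ∈ uIcc a b, Integrable fun x : ℝ => f (x + c * Complex.I) := by
    intro c hcc
    refine hB.mono' (Continuous.aestronglyMeasurable ?_) (Eventually.of_forall fun x => ?_)
    · exact hc.comp_continuous (by fun_prop) (fun x => by simpa using hcc)
    · simpa using hf (x + c * Complex.I) (by simpa using hcc)
  have hlim : ∀ c ∈ uIcc a b, Tendsto (fun T : ℝ => ∫ x in (-T)..T, f (x + c * Complex.I)) atTop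
      (𝓝 (∫ x : ℝ, f (x + c * Complex.I))) := fun c hcc =>
    intervalIntegral_tendsto_integral (hint c hcc) tendsto_neg_atTop_atBot tendsto_id
  have hside : ∀ (u : ℝ → ℝ), Tendsto (fun T => B (u T)) atTop (𝓝 0) →
      Tendsto (fun T => Complex.I • ∫ y in a..b, f (u T + y * Complex.I)) atTop (𝓝 0) := by
    intro u hu
    refine squeeze_zero_norm (a := fun T => B (u T) * |b - a|) (fun T => ?_)
      (by simpa using hu.mul_const |b - a|)
    rw [norm_smul, Complex.norm_I, one_mul]
    refine intervalIntegral.norm_integral_le_of_norm_le_const fun y hy => ?_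
    simpa using hf (u T + y * Complex.I) (by simpa using uIoc_subset_uIcc hy)
  have hrect : ∀ T : ℝ, (∫ x in (-T)..T, f (x + a * Complex.I))
      - (∫ x in (-T)..T, f (x + b * Complex.I))
      + Complex.I • (∫ y in a..b, f ((T : ℝ) + y * Complex.I))
      - Complex.I • (∫ y in a..b, f ((-T : ℝ) + y * Complex.I)) = 0 := by
    intro T
    have := Complex.integral_boundary_rect_eq_zero_of_continuousOn_of_differentiableOn f
      (⟨-T, a⟩ : ℂ) (⟨T, b⟩ : ℂ) (hc.mono fun w hw => hw.2) (hd.mono fun w hw => hw.2)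
    simpa using this
  have h0 := (((hlim a left_mem_uIcc).sub (hlim b right_mem_uIcc)).add
    (hside (fun T => T) htop)).sub (hside (fun T => -T) (hbot.comp tendsto_neg_atTop_atBot))
  simp only [hrect, add_zero, sub_zero] at h0
  exact (sub_eq_zero.mp (tendsto_nhds_unique h0 tendsto_const_nhds)).symm ▸ rfl

theorem integrable_of_le_exp {f : ℝ → ℝ} {p q C : ℝ} (hf : Continuous f) (hp : 0 < p) (hq : 0 < q)
    (h0 : ∀ x, 0 ≤ f x) (h1 : ∀ x, f x ≤ C * exp (p * x)) (h2 : ∀ x, f x ≤ C * exp (-q * x)) :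
    Integrable f ∧ Tendsto f atBot (𝓝 0) ∧ Tendsto f atTop (𝓝 0) := by
  refine ⟨?_, ?_, ?_⟩
  · rw [← integrableOn_univ, ← Iic_union_Ioi (a := (0 : ℝ))]
    refine IntegrableOn.union ?_ ?_
    · refine ((integrableOn_exp_mul_Iic hp 0).const_mul C).mono' hf.aestronglyMeasurable
        (Eventually.of_forall fun x => ?_)
      rw [norm_of_nonneg (h0 x)]; exact h1 x
    · refine ((exp_neg_integrableOn_Ioi 0 hq).const_mul C).mono' hf.aestronglyMeasurable
        (Eventually.of_forall fun x => ?_)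
      rw [norm_of_nonneg (h0 x)]; exact h2 x
  · refine squeeze_zero h0 h1 ?_
    simpa using (tendsto_exp_atBot.comp (tendsto_id.const_mul_atBot hp)).const_mul C
  · refine squeeze_zero h0 h2 ?_
    simpa using (tendsto_exp_atBot.comp
      (tendsto_id.const_mul_atTop_of_neg (neg_lt_zero.mpr hq))).const_mul C

theorem integrable_exp_div_one_add_exp {a q : ℝ} (ha : 0 < a) (haq : a < q) (C : ℝ) (hC : 0 ≤ C) :
    Integrable (fun x => C * exp (a * x) / (1 + exp (q * x))) ∧
      Tendsto (fun x => C * exp (a * x) / (1 + exp (q * x))) atBot (𝓝 0) ∧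
      Tendsto (fun x => C * exp (a * x) / (1 + exp (q * x))) atTop (𝓝 0) := by
  refine integrable_of_le_exp (p := a) (q := q - a) (C := C) ?_ ha (sub_pos.mpr haq) ?_ ?_ ?_
  · exact Continuous.div (by fun_prop) (by fun_prop) (fun x => by positivity)
  · intro x; positivity
  · intro x
    refine div_le_self (by positivity) ?_
    linarith [exp_pos (q * x)]
  · intro x
    rw [div_le_iff₀ (by positivity)]
    have : C * exp (a * x) = C * exp (-(q - a) * x) * exp (q * x) := by
      rw [mul_assoc, ← exp_add]; ring_nf
    rw [this]
    have : 0 ≤ C * exp (-(q - a) * x) := by positivity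
    nlinarith

/-- A lower bound for `1 + e ^ w` away from its zeros. -/
theorem le_norm_one_add_cexp {w : ℂ} {θ : ℝ} (hw : |w.im| ≤ θ) (hθ : θ ≤ π) :
    cos (θ / 2) * (1 + exp w.re) ≤ ‖1 + Complex.exp w‖ := by
  have hθ0 : 0 ≤ θ := (abs_nonneg _).trans hw
  have hc0 : 0 ≤ cos (θ / 2) := cos_nonneg_of_mem_Icc ⟨by linarith, by linarith⟩
  refine le_trans ?_ (Complex.abs_re_le_norm _ |>.trans_eq ?_)
    (b := |(Complex.exp (-((w.im / 2 : ℝ) : ℂ) * Complex.I) * (1 + Complex.exp w)).re|)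
  · have hre : (Complex.exp (-((w.im / 2 : ℝ) : ℂ) * Complex.I) * (1 + Complex.exp w)).re
        = cos (w.im / 2) * (1 + exp w.re) := by
      rw [mul_add, mul_one, ← Complex.exp_add, Complex.add_re, Complex.exp_re, Complex.exp_re]
      have : w.im - w.im / 2 = w.im / 2 := by ring
      simp only [Complex.mul_re, Complex.neg_re, Complex.ofReal_re, Complex.I_re, mul_zero,
        Complex.neg_im, Complex.ofReal_im, Complex.I_im, mul_one, Complex.mul_im, Complex.add_re,
        Complex.add_im, neg_zero, sub_zero, add_zero, exp_zero, one_mul, zero_add,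
        cos_neg]
      rw [show -(w.im / 2) + w.im = w.im / 2 by ring]; ring
    rw [hre]
    refine le_trans ?_ (le_abs_self _)
    refine mul_le_mul_of_nonneg_right ?_ (by positivity)
    rw [← cos_abs (w.im / 2)]
    refine cos_le_cos_of_nonneg_of_le_pi (abs_nonneg _) (by linarith) ?_
    rw [abs_div, abs_two]; linarith
  · rw [norm_mul, show -((w.im / 2 : ℝ) : ℂ) * Complex.I = ((-(w.im / 2) : ℝ) : ℂ) * Complex.I by
      push_cast; ring, Complex.norm_exp_ofReal_mul_I, one_mul]

theorem norm_inv_one_add_cexp_le {w : ℂ} {θ : ℝ} (hw : |w.im| ≤ θ) (hθ : θ < π) :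
    ‖(1 + Complex.exp w)⁻¹‖ ≤ (cos (θ / 2))⁻¹ / (1 + exp w.re) := by
  have hθ0 : 0 ≤ θ := (abs_nonneg _).trans hw
  have hc0 : 0 < cos (θ / 2) := cos_pos_of_mem_Ioo ⟨by linarith, by linarith⟩
  rw [norm_inv, inv_eq_one_div (cos _), div_div, inv_eq_one_div]
  exact one_div_le_one_div_of_le (by positivity) (le_norm_one_add_cexp hw hθ.le)

theorem one_add_cexp_ne_zero {w : ℂ} (hw : |w.im| < π) : 1 + Complex.exp w ≠ 0 := by
  have hc0 : 0 < cos (|w.im| / 2) :=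
    cos_pos_of_mem_Ioo ⟨by linarith [abs_nonneg w.im, pi_pos], by linarith⟩
  have := le_norm_one_add_cexp le_rfl hw.le
  exact norm_pos_iff.mp (lt_of_lt_of_le (by positivity) this)

theorem setIntegral_Ioi_eq_integral_exp {E : Type*} [NormedAddCommGroup E] [NormedSpace ℝ E]
    (f : ℝ → E) :
    ∫ x in Ioi (0 : ℝ), f x = ∫ x : ℝ, exp x • f (exp x) := by
  have := integral_image_eq_integral_abs_deriv_smul MeasurableSet.univ
    (fun x _ => (Real.hasDerivAt_exp x).hasDerivWithinAt) exp_injective.injOn f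
  rw [image_univ, range_exp] at this
  simpa [abs_of_pos (exp_pos _)] using this

theorem integrableOn_Ioi_iff_integrable_exp {E : Type*} [NormedAddCommGroup E] [NormedSpace ℝ E]
    (f : ℝ → E) :
    IntegrableOn f (Ioi 0) ↔ Integrable fun x : ℝ => exp x • f (exp x) := by
  have := integrableOn_image_iff_integrableOn_abs_deriv_smul MeasurableSet.univ
    (fun x _ => (Real.hasDerivAt_exp x).hasDerivWithinAt) exp_injective.injOn f
  rw [image_univ, range_exp] at this
  simpa [abs_of_pos (exp_pos _)] using this

theorem integral_rpow_div_one_add {a : ℝ} (ha : 0 < a) (ha1 : a < 1) :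
    ∫ q in Ioi (0 : ℝ), q ^ (a - 1) / (1 + q) = π / sin (π * a) := by
  have hswap : ∫ q in Ioi (0 : ℝ), ∫ v in Ioi (0 : ℝ), q ^ (a - 1) * exp (-(v * q)) * exp (-v)
      = ∫ v in Ioi (0 : ℝ), ∫ q in Ioi (0 : ℝ), q ^ (a - 1) * exp (-(v * q)) * exp (-v) := by
    refine integral_integral_swap
      (f := fun q v : ℝ => q ^ (a - 1) * exp (-(v * q)) * exp (-v)) ?_
    have hm : Measurable (Function.uncurry
        fun q v : ℝ => q ^ (a - 1) * exp (-(v * q)) * exp (-v)) := by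
      unfold Function.uncurry; fun_prop
    rw [integrable_prod_iff' hm.aestronglyMeasurable]
    constructor
    · filter_upwards [ae_restrict_mem measurableSet_Ioi] with v hv
      have := integrableOn_rpow_mul_exp_neg_mul_rpow (s := a - 1) (p := 1) (b := v)
        (by linarith) one_pos hv
      simp only [rpow_one, neg_mul] at this
      exact this.mul_const (exp (-v))
    · have : IntegrableOn (fun v : ℝ => Gamma a * (exp (-v) * v ^ ((1 - a) - 1))) (Ioi 0) :=
        (GammaIntegral_convergent (by linarith)).const_mul _
      refine this.congr_fun (fun v (hv : 0 < v) => ?_) measurableSet_Ioi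
      have h := integral_rpow_mul_exp_neg_mul_Ioi ha hv
      simp only [Function.uncurry]
      rw [setIntegral_congr_fun measurableSet_Ioi (g := fun q : ℝ =>
        q ^ (a - 1) * exp (-(v * q)) * exp (-v))
        (fun q (hq : 0 < q) => norm_of_nonneg (by positivity)), integral_mul_const, h,
        one_div, inv_rpow hv.le, ← rpow_neg hv.le, show (1 - a - 1) = -a by ring]
      ring
  have hl : ∫ q in Ioi (0 : ℝ), ∫ v in Ioi (0 : ℝ), q ^ (a - 1) * exp (-(v * q)) * exp (-v)
      = ∫ q in Ioi (0 : ℝ), q ^ (a - 1) / (1 + q) := by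
    refine setIntegral_congr_fun measurableSet_Ioi fun q (hq : 0 < q) => ?_
    have h := integral_rpow_mul_exp_neg_mul_Ioi one_pos (show 0 < 1 + q by positivity)
    simp only [sub_self, rpow_zero, one_mul, rpow_one, Gamma_one, mul_one] at h
    rw [div_eq_mul_one_div, ← h, ← integral_const_mul]
    refine integral_congr_ae (Eventually.of_forall fun v => ?_)
    simp only
    rw [mul_assoc, ← exp_add]; ring_nf
  have hr : ∫ v in Ioi (0 : ℝ), ∫ q in Ioi (0 : ℝ), q ^ (a - 1) * exp (-(v * q)) * exp (-v)
      = Gamma a * Gamma (1 - a) := by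
    rw [Gamma_eq_integral (s := 1 - a) (by linarith), ← integral_const_mul]
    refine setIntegral_congr_fun measurableSet_Ioi fun v (hv : 0 < v) => ?_
    have h := integral_rpow_mul_exp_neg_mul_Ioi ha hv
    rw [integral_mul_const, h,
        one_div, inv_rpow hv.le, ← rpow_neg hv.le, show (1 - a - 1) = -a by ring]
    ring
  rw [← hl, hswap, hr, Gamma_mul_Gamma_one_sub]

theorem integral_cexp_div_one_add_cexp {a θ : ℝ} (ha : 0 < a) (ha1 : a < 1) (hθ : |θ| < π) :
    ∫ x : ℝ, Complex.exp (a * (x + θ * Complex.I)) / (1 + Complex.exp (x + θ * Complex.I))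
      = ((π / sin (π * a) : ℝ) : ℂ) := by
  have hcos : 0 < cos (|θ| / 2) :=
    cos_pos_of_mem_Ioo ⟨by linarith [abs_nonneg θ, pi_pos], by linarith⟩
  obtain ⟨hB, hbot, htop⟩ := integrable_exp_div_one_add_exp ha ha1 (cos (|θ| / 2))⁻¹
    (by positivity)
  have him : ∀ w : ℂ, w.im ∈ uIcc θ 0 → |w.im| ≤ |θ| := by
    intro w hw
    simpa using abs_sub_right_of_mem_uIcc hw
  have hne : ∀ w : ℂ, w.im ∈ uIcc θ 0 → 1 + Complex.exp w ≠ 0 := fun w hw =>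
    one_add_cexp_ne_zero ((him w hw).trans_lt hθ)
  have key := integral_horizontal_line_eq
    (f := fun w => Complex.exp (a * w) / (1 + Complex.exp w)) (a := θ) (b := 0)
    (ContinuousOn.div (by fun_prop) (by fun_prop) hne)
    (DifferentiableOn.div (by fun_prop) (by fun_prop)
      fun w hw => hne w (Ioo_subset_Icc_self hw)) hB hbot htop ?_
  · rw [key, ← integral_rpow_div_one_add ha ha1, ← integral_complex_ofReal,
      setIntegral_Ioi_eq_integral_exp]
    refine integral_congr_ae (Eventually.of_forall fun x => ?_)
    simp only [Complex.ofReal_zero, zero_mul, add_zero, Complex.real_smul]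
    rw [← exp_mul, show exp (x * (a - 1)) = exp (a * x) / exp x by rw [← exp_sub]; ring_nf]
    have : (Complex.exp x) ≠ 0 := Complex.exp_ne_zero _
    push_cast
    field_simp
  · intro w hw
    have h := norm_inv_one_add_cexp_le (him w hw) hθ
    rw [norm_div, Complex.norm_exp, div_eq_mul_inv, ← norm_inv]
    have : ((a : ℂ) * w).re = a * w.re := by simp
    rw [this, one_mul]
    calc _ ≤ exp (a * w.re) * ((cos (|θ| / 2))⁻¹ / (1 + exp w.re)) := by gcongr
      _ = _ := by ring

/-- Euler's integral along a rotated ray, with the rate written as `exp w`. -/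
theorem integral_rpow_mul_cexp_neg_mul_cexp {z : ℝ} {w : ℂ} (hz : 0 < z) (hw : |w.im| < π / 2) :
    ∫ t in Ioi (0 : ℝ), ((t ^ (z - 1) : ℝ) : ℂ) * Complex.exp (-(t * Complex.exp w))
      = Gamma z * Complex.exp (-(z * w)) := by
  set F : ℂ → ℂ := fun w => Complex.exp (z * w) * Complex.exp (-Complex.exp w) with hF
  have hk : 0 < cos |w.im| := cos_pos_of_mem_Ioo ⟨by linarith [abs_nonneg w.im, pi_pos], hw⟩
  have hre : ∀ x : ℝ, exp (z * x) * exp (-(cos |w.im|) * exp x)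
      = exp x ^ z * exp (-(cos |w.im|) * exp x) := by
    intro x
    rw [← exp_mul, mul_comm z]
  have key := integral_horizontal_line_eq (f := F) (a := w.im) (b := 0)
    (B := fun x => exp (z * x) * exp (-(cos |w.im|) * exp x))
    (by fun_prop) (by fun_prop) ?_ ?_ ?_ ?_
  · have h1 : ∫ t in Ioi (0 : ℝ), ((t ^ (z - 1) : ℝ) : ℂ) * Complex.exp (-(t * Complex.exp w))
        = ∫ x : ℝ, Complex.exp (-(z * w)) * F (((x + w.re : ℝ) : ℂ) + w.im * Complex.I) := by
      rw [setIntegral_Ioi_eq_integral_exp]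
      refine integral_congr_ae (Eventually.of_forall fun x => ?_)
      have : (((x + w.re : ℝ) : ℂ) + w.im * Complex.I) = x + w := by
        conv_rhs => rw [← Complex.re_add_im w]
        push_cast; ring
      simp only [this, hF, Complex.real_smul]
      rw [← exp_mul]
      push_cast
      simp only [← Complex.exp_add]
      congr 1; ring
    rw [h1, integral_const_mul, integral_add_right_eq_self
      (fun x : ℝ => F ((x : ℂ) + w.im * Complex.I)) w.re, key, mul_comm,
      Gamma_eq_integral hz, ← integral_complex_ofReal,
      setIntegral_Ioi_eq_integral_exp]
    congr 1
    refine integral_congr_ae (Eventually.of_forall fun x => ?_)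
    simp only [hF, Complex.ofReal_zero, zero_mul, add_zero, Complex.real_smul]
    rw [← exp_mul]
    push_cast
    simp only [← Complex.exp_add]
    congr 1; ring
  · simp only [hre]
    have := (integrableOn_Ioi_iff_integrable_exp
      (fun t => ((t ^ (z - 1) * exp (-(cos |w.im|) * t) : ℝ) : ℂ))).1
      (by
        have := integrableOn_rpow_mul_exp_neg_mul_rpow (s := z - 1) (p := 1) (b := cos |w.im|)
          (by linarith) one_pos hk
        simp only [rpow_one] at this
        exact this.ofReal)
    refine this.re.congr (Eventually.of_forall fun x => ?_)
    simp only [Complex.real_smul, ← Complex.ofReal_mul, RCLike.re_to_complex, Complex.ofReal_re]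
    rw [← mul_assoc, rpow_sub (exp_pos x), rpow_one, mul_div_cancel₀ _ (exp_pos x).ne']
  · simp only [hre]
    have : Tendsto (fun y : ℝ => y ^ z * exp (-(cos |w.im|) * y)) (𝓝 0) (𝓝 0) := by
      have : ContinuousAt (fun y : ℝ => y ^ z * exp (-(cos |w.im|) * y)) 0 :=
        ((continuous_rpow_const hz.le).mul (by fun_prop)).continuousAt
      simpa [ContinuousAt, zero_rpow hz.ne'] using this
    exact this.comp tendsto_exp_atBot
  · simp only [hre]
    exact (tendsto_rpow_mul_exp_neg_mul_atTop_nhds_zero z _ hk).comp tendsto_exp_atTop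
  · intro v hv
    have hv' : |v.im| ≤ |w.im| := by simpa using abs_sub_right_of_mem_uIcc hv
    have h2 : cos |w.im| ≤ cos v.im := by
      rw [← cos_abs v.im]
      exact cos_le_cos_of_nonneg_of_le_pi (abs_nonneg _) (by linarith [pi_pos]) hv'
    rw [hF]
    simp only [norm_mul, Complex.norm_exp, Complex.neg_re, Complex.exp_re, Complex.re_ofReal_mul]
    gcongr
    have := mul_le_mul_of_nonneg_right h2 (exp_pos v.re).le
    linarith

/-- The function `t ↦ t ^ (α - 1) E_{α,α}(-t ^ α)`, with `E` the Mittag-Leffler function. -/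
noncomputable def mittagLefflerKernel (α t : ℝ) : ℝ :=
  ∑' n : ℕ, (-1) ^ n * (t ^ (α * ((n : ℝ) + 1) - 1) / Gamma (α * ((n : ℝ) + 1)))

theorem rpow_div_Gamma_le {a t : ℝ} (ha : 1 ≤ a) (ht : 0 ≤ t) :
    t ^ (a - 1) / Gamma a ≤ exp (3 / 2 * (t + 1)) * (1 / (3 / 2)) ^ a := by
  have ha0 : 0 < a := by linarith
  rw [div_le_iff₀ (Gamma_pos_of_pos ha0), mul_assoc,
    ← integral_rpow_mul_exp_neg_mul_Ioi ha0 (show (0 : ℝ) < 3 / 2 by norm_num)]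
  have hint : IntegrableOn (fun x : ℝ => x ^ (a - 1) * exp (-(3 / 2 * x))) (Ioi 0) := by
    have := integrableOn_rpow_mul_exp_neg_mul_rpow (s := a - 1) (p := 1) (b := 3 / 2)
      (by linarith) one_pos (show (0 : ℝ) < 3 / 2 by norm_num)
    simpa using this
  have h1 : ∫ x in Ioc t (t + 1), t ^ (a - 1) * exp (-(3 / 2 * (t + 1)))
      ≤ ∫ x in Ioc t (t + 1), x ^ (a - 1) * exp (-(3 / 2 * x)) := by
    refine setIntegral_mono_on (integrableOn_const (by simp)) (hint.mono_set fun x hx =>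
      ht.trans_lt hx.1) measurableSet_Ioc fun x hx => ?_
    have : t ≤ x := hx.1.le
    have : x ≤ t + 1 := hx.2
    have : 0 ≤ x := ht.trans hx.1.le
    gcongr
  have h2 : ∫ x in Ioc t (t + 1), x ^ (a - 1) * exp (-(3 / 2 * x))
      ≤ ∫ x in Ioi 0, x ^ (a - 1) * exp (-(3 / 2 * x)) := by
    refine setIntegral_mono_set hint ?_ (LE.le.eventuallyLE fun x hx => ht.trans_lt hx.1)
    filter_upwards [ae_restrict_mem measurableSet_Ioi] with x (hx : 0 < x)
    positivity
  simp only [integral_const, smul_eq_mul, Measure.real, Measure.restrict_apply_univ,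
    Real.volume_Ioc, add_sub_cancel_left, ENNReal.toReal_ofReal zero_le_one, one_mul] at h1
  calc t ^ (a - 1) = exp (3 / 2 * (t + 1)) * (t ^ (a - 1) * exp (-(3 / 2 * (t + 1)))) := by
        rw [mul_left_comm, ← exp_add]; simp
    _ ≤ _ := by gcongr; exact h1.trans h2

theorem mittagLefflerKernel_term_le {α t : ℝ} (hα : 1 < α) (ht : 0 ≤ t) (n : ℕ) :
    ‖(-1 : ℝ) ^ n * (t ^ (α * ((n : ℝ) + 1) - 1) / Gamma (α * ((n : ℝ) + 1)))‖
      ≤ exp (3 / 2 * (t + 1)) * (2 / 3) ^ n := by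
  have hn : (n : ℝ) + 1 ≤ α * ((n : ℝ) + 1) := le_mul_of_one_le_left (by positivity) hα.le
  have hn0 : (0 : ℝ) ≤ n := n.cast_nonneg
  have hG := Gamma_pos_of_pos (show 0 < α * ((n : ℝ) + 1) by linarith)
  rw [norm_mul, norm_pow, norm_neg, norm_one, one_pow, one_mul, norm_of_nonneg (by positivity)]
  refine (rpow_div_Gamma_le (by linarith) ht).trans ?_
  rw [show (1 : ℝ) / (3 / 2) = 2 / 3 by norm_num]
  gcongr
  rw [← rpow_natCast (2 / 3)]
  exact rpow_le_rpow_of_exponent_ge (by norm_num) (by norm_num) (by linarith)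

theorem continuousOn_mittagLefflerKernel {α : ℝ} (hα : 1 < α) :
    ContinuousOn (mittagLefflerKernel α) (Ioi 0) := by
  intro t (ht : 0 < t)
  have h : ContinuousOn (mittagLefflerKernel α) (Ioo 0 (t + 1)) := by
    refine continuousOn_tsum (u := fun n : ℕ => exp (3 / 2 * (t + 1 + 1)) * (2 / 3 : ℝ) ^ n)
      (fun n => Continuous.continuousOn ?_)
      ((summable_geometric_of_lt_one (by norm_num) (by norm_num : (2 / 3 : ℝ) < 1)).mul_left _)
      (fun n x hx => (mittagLefflerKernel_term_le hα hx.1.le n).trans ?_)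
    · have hn : (n : ℝ) + 1 ≤ α * ((n : ℝ) + 1) := le_mul_of_one_le_left (by positivity) hα.le
      have hn0 : (0 : ℝ) ≤ n := n.cast_nonneg
      have := continuous_rpow_const (show 0 ≤ α * ((n : ℝ) + 1) - 1 by linarith)
      fun_prop
    · have := hx.2.le
      gcongr
  exact (h.continuousAt (Ioo_mem_nhds ht (by linarith))).continuousWithinAt

theorem abs_mittagLefflerKernel_le {α t : ℝ} (hα : 1 < α) (ht : 0 ≤ t) :
    |mittagLefflerKernel α t| ≤ 3 * exp (3 / 2 * (t + 1)) := by
  have h := tsum_of_norm_bounded ((hasSum_geometric_of_lt_one (by norm_num)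
    (by norm_num : (2 / 3 : ℝ) < 1)).mul_left _) (mittagLefflerKernel_term_le hα ht)
  rw [norm_eq_abs] at h
  refine h.trans_eq ?_
  norm_num [mul_comm]

theorem integrableOn_exp_mul_mittagLefflerKernel {α : ℝ} (hα : 1 < α) :
    IntegrableOn (fun t => exp (-(2 * t)) * mittagLefflerKernel α t) (Ioi 0) := by
  have h : IntegrableOn (fun t : ℝ => 3 * exp (3 / 2) * exp (-(1 / 2) * t)) (Ioi 0) :=
    (integrableOn_exp_mul_Ioi (by norm_num) 0).const_mul _
  refine h.mono' (((Continuous.continuousOn (by fun_prop)).mul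
    (continuousOn_mittagLefflerKernel hα)).aestronglyMeasurable measurableSet_Ioi) ?_
  filter_upwards [ae_restrict_mem measurableSet_Ioi] with t (ht : 0 < t)
  rw [norm_mul, norm_eq_abs, norm_eq_abs, abs_of_pos (exp_pos _)]
  calc _ ≤ exp (-(2 * t)) * (3 * exp (3 / 2 * (t + 1))) := by
        gcongr; exact abs_mittagLefflerKernel_le hα ht.le
    _ = _ := by
        rw [mul_left_comm, mul_assoc, ← exp_add, ← exp_add]; ring_nf

theorem integrableOn_rpow_div_Gamma_mul_exp {a : ℝ} (ha : 0 < a) :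
    IntegrableOn (fun t : ℝ => t ^ (a - 1) / Gamma a * exp (-(2 * t))) (Ioi 0) ∧
      ∫ t in Ioi (0 : ℝ), t ^ (a - 1) / Gamma a * exp (-(2 * t)) = (1 / 2) ^ a := by
  constructor
  · have := integrableOn_rpow_mul_exp_neg_mul_rpow (s := a - 1) (p := 1) (b := 2)
      (by linarith) one_pos two_pos
    simp only [rpow_one, neg_mul] at this
    refine (this.div_const (Gamma a)).congr (Eventually.of_forall fun t => ?_)
    simp only; ring
  · have h : ∀ t : ℝ, t ^ (a - 1) / Gamma a * exp (-(2 * t))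
        = t ^ (a - 1) * exp (-(2 * t)) / Gamma a := fun t => by ring
    simp only [h]
    rw [integral_div, integral_rpow_mul_exp_neg_mul_Ioi ha two_pos,
      mul_div_cancel_right₀ _ (Gamma_pos_of_pos ha).ne']

theorem abs_im_log_lt {l : ℂ} (hl : 0 < l.re) : |(Complex.log l).im| < π / 2 := by
  rw [Complex.log_im]
  exact Complex.abs_arg_lt_pi_div_two_iff.2 (Or.inl hl)

theorem integral_cexp_mul_mittagLefflerKernel {α : ℝ} (hα : 1 < α) {l : ℂ} (hl : l.re = 2) :
    ∫ t in Ioi (0 : ℝ), Complex.exp (-(t * l)) * (mittagLefflerKernel α t : ℂ)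
      = (1 + l ^ (α : ℂ))⁻¹ := by
  have hl0 : l ≠ 0 := by rintro rfl; simp at hl
  have hpos : ∀ n : ℕ, 0 < α * ((n : ℝ) + 1) := fun n => by positivity
  set u : ℕ → ℝ → ℂ := fun n t => Complex.exp (-(t * l)) *
    (((-1 : ℝ) ^ n * (t ^ (α * ((n : ℝ) + 1) - 1) / Gamma (α * ((n : ℝ) + 1))) : ℝ) : ℂ) with hu
  have hnorm : ∀ n : ℕ, ∀ t ∈ Ioi (0 : ℝ), ‖u n t‖ =
      t ^ (α * ((n : ℝ) + 1) - 1) / Gamma (α * ((n : ℝ) + 1)) * exp (-(2 * t)) := by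
    intro n t (ht : 0 < t)
    have hG := Gamma_pos_of_pos (hpos n)
    have : (-(t * l)).re = -(2 * t) := by simp [hl, mul_comm]
    rw [hu]
    simp only [norm_mul, Complex.norm_exp, Complex.norm_real, norm_pow, norm_neg, norm_one,
      one_pow, one_mul, this]
    rw [norm_of_nonneg (by positivity), mul_comm]
  have hint : ∀ n, IntegrableOn (u n) (Ioi 0) := by
    intro n
    have hm : Measurable (u n) := by
      rw [hu]; fun_prop
    refine ((integrableOn_rpow_div_Gamma_mul_exp (hpos n)).1).mono' hm.aestronglyMeasurable ?_
    filter_upwards [ae_restrict_mem measurableSet_Ioi] with t ht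
    exact (hnorm n t ht).le
  have hval : ∀ n, ∫ t in Ioi (0 : ℝ), u n t
      = (-1) ^ n * Complex.exp (-(α * Complex.log l)) ^ (n + 1) := by
    intro n
    have h := integral_rpow_mul_cexp_neg_mul_cexp (hpos n) (abs_im_log_lt (l := l) (by linarith))
    rw [Complex.exp_log hl0] at h
    have hG : (Gamma (α * ((n : ℝ) + 1)) : ℂ) ≠ 0 := by
      exact_mod_cast (Gamma_pos_of_pos (hpos n)).ne'
    have h3 : ∀ t : ℝ, u n t = (-1) ^ n / (Gamma (α * ((n : ℝ) + 1)) : ℂ) *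
        (((t ^ (α * ((n : ℝ) + 1) - 1) : ℝ) : ℂ) * Complex.exp (-(t * l))) := by
      intro t
      rw [hu]; push_cast; ring
    simp only [h3]
    rw [integral_const_mul, h, ← Complex.exp_nat_mul]
    push_cast
    field_simp
  have hlim := hasSum_integral_of_summable_integral_norm hint ?_
  · have hsum : ∀ t : ℝ, ∑' n, u n t =
        Complex.exp (-(t * l)) * (mittagLefflerKernel α t : ℂ) := by
      intro t
      rw [mittagLefflerKernel, Complex.ofReal_tsum, ← tsum_mul_left]
    simp only [hsum, hval] at hlim
    refine hlim.unique ?_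
    set q := Complex.exp (-(α * Complex.log l)) with hq
    have hq1 : ‖-q‖ < 1 := by
      rw [norm_neg, hq, Complex.norm_exp, exp_lt_one_iff]
      simp only [Complex.neg_re, Complex.re_ofReal_mul, Complex.log_re]
      have : 1 < ‖l‖ := by
        have := Complex.abs_re_le_norm l
        rw [hl, abs_two] at this; linarith
      have := log_pos this
      simp only [Left.neg_neg_iff]; positivity
    have h5 := (hasSum_geometric_of_norm_lt_one hq1).mul_left q
    have h6 : l ^ (α : ℂ) = q⁻¹ := by
      rw [Complex.cpow_def_of_ne_zero hl0, hq, Complex.exp_neg, inv_inv, mul_comm]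
    have hq0 : q ≠ 0 := Complex.exp_ne_zero _
    have h7 : (1 + l ^ (α : ℂ))⁻¹ = q * (1 - -q)⁻¹ := by
      rw [h6, sub_neg_eq_add]
      rw [show 1 + q⁻¹ = (1 + q) * q⁻¹ by field_simp; ring, mul_inv, inv_inv, mul_comm]
    rw [h7]
    have h8 : (fun i : ℕ => q * (-q) ^ i) = fun i : ℕ => (-1) ^ i * q ^ (i + 1) := by
      funext n
      rw [neg_pow]; ring
    rwa [h8] at h5
  · have : ∀ n, ∫ t in Ioi (0 : ℝ), ‖u n t‖ = (1 / 2) ^ (α * ((n : ℝ) + 1)) := fun n => by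
      rw [setIntegral_congr_fun measurableSet_Ioi (hnorm n)]
      exact (integrableOn_rpow_div_Gamma_mul_exp (hpos n)).2
    simp only [this]
    refine Summable.of_nonneg_of_le (fun n => by positivity) (fun n => ?_) summable_geometric_two
    rw [← rpow_natCast (1 / 2)]
    refine rpow_le_rpow_of_exponent_ge (by norm_num) (by norm_num) ?_
    have hn : (n : ℝ) + 1 ≤ α * ((n : ℝ) + 1) := le_mul_of_one_le_left (by positivity) hα.le
    linarith

theorem norm_inv_one_add_cpow_le {α : ℝ} (hα : α ∈ Ioo (1 : ℝ) 2) {l : ℂ} (hl : 0 ≤ l.re) :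
    1 + l ^ (α : ℂ) ≠ 0 ∧
    ‖(1 + l ^ (α : ℂ))⁻¹‖ ≤ 2 * (cos (α * (π / 2) / 2))⁻¹ * (1 + |l.im|) ^ (-α) := by
  obtain ⟨h1, h2⟩ := hα
  have hθ : α * (π / 2) < π := by nlinarith [pi_pos]
  have hθ0 : 0 < α * (π / 2) := by positivity
  have hc : 0 < cos (α * (π / 2) / 2) := cos_pos_of_mem_Ioo ⟨by linarith, by linarith⟩
  have hpow : (1 + ‖l‖) ^ α ≤ 2 * (1 + ‖l‖ ^ α) := by
    have : (1 + ‖l‖) ^ α ≤ 2 ^ (α - 1) * (1 ^ α + ‖l‖ ^ α) := by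
      exact_mod_cast NNReal.rpow_add_le_mul_rpow_add_rpow 1 ‖l‖₊ h1.le
    rw [one_rpow] at this
    refine this.trans ?_
    gcongr
    calc (2 : ℝ) ^ (α - 1) ≤ 2 ^ (1 : ℝ) := by gcongr <;> linarith
      _ = 2 := by simp
  have hkey : 1 + l ^ (α : ℂ) ≠ 0 ∧ ‖(1 + l ^ (α : ℂ))⁻¹‖
      ≤ (cos (α * (π / 2) / 2))⁻¹ / (1 + ‖l‖ ^ α) := by
    by_cases hl0 : l = 0
    · subst hl0
      have : (α : ℂ) ≠ 0 := by exact_mod_cast (by linarith : α ≠ 0)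
      rw [Complex.zero_cpow this]
      simp only [add_zero, ne_eq, one_ne_zero, not_false_eq_true, inv_one, norm_one, norm_zero,
        true_and]
      rw [zero_rpow (by linarith), add_zero, div_one]
      exact (one_le_inv₀ hc).2 (cos_le_one _)
    · have hw : |(α * Complex.log l).im| ≤ α * (π / 2) := by
        rw [Complex.im_ofReal_mul, abs_mul, abs_of_pos (by linarith), Complex.log_im]
        gcongr
        exact Complex.abs_arg_le_pi_div_two_iff.2 hl
      have h4 : exp (α * Complex.log l).re = ‖l‖ ^ α := by
        rw [Complex.re_ofReal_mul, Complex.log_re, rpow_def_of_pos (norm_pos_iff.2 hl0), mul_comm]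
      have h5 := norm_inv_one_add_cexp_le hw hθ
      have h6 := one_add_cexp_ne_zero (hw.trans_lt hθ)
      rw [h4] at h5
      rw [Complex.cpow_def_of_ne_zero hl0, mul_comm]
      exact ⟨h6, h5⟩
  have h0 : 0 < 1 + ‖l‖ ^ α := by positivity
  refine ⟨hkey.1, hkey.2.trans ?_⟩
  calc (cos (α * (π / 2) / 2))⁻¹ / (1 + ‖l‖ ^ α)
      ≤ (cos (α * (π / 2) / 2))⁻¹ * (2 * (1 + ‖l‖) ^ (-α)) := by
        rw [div_eq_mul_inv]
        refine mul_le_mul_of_nonneg_left ?_ (inv_pos.2 hc).le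
        rw [rpow_neg (by positivity), ← div_eq_mul_inv, inv_le_comm₀ h0 (by positivity), inv_div]
        linarith
    _ ≤ (cos (α * (π / 2) / 2))⁻¹ * (2 * (1 + |l.im|) ^ (-α)) := by
        refine mul_le_mul_of_nonneg_left ?_ (inv_pos.2 hc).le
        have := Complex.abs_im_le_norm l
        have := rpow_le_rpow_of_nonpos (z := -α) (show 0 < 1 + |l.im| by positivity)
          (show 1 + |l.im| ≤ 1 + ‖l‖ by linarith) (by linarith)
        linarith
    _ = _ := by ring

theorem integrable_one_add_abs_rpow_neg {α : ℝ} (hα : 1 < α) (C : ℝ) :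
    Integrable (fun x : ℝ => C * (1 + |x|) ^ (-α)) ∧
      Tendsto (fun x : ℝ => C * (1 + |x|) ^ (-α)) atBot (𝓝 0) ∧
      Tendsto (fun x : ℝ => C * (1 + |x|) ^ (-α)) atTop (𝓝 0) := by
  have h := tendsto_rpow_neg_atTop (show 0 < α by linarith)
  refine ⟨(integrable_one_add_norm (by simpa using hα)).const_mul C, ?_, ?_⟩
  · have := (h.comp (tendsto_const_nhds.add_atTop tendsto_abs_atBot_atTop :
      Tendsto (fun x : ℝ => 1 + |x|) atBot atTop)).const_mul C
    simpa using this
  · have := (h.comp (tendsto_const_nhds.add_atTop tendsto_abs_atTop_atTop :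
      Tendsto (fun x : ℝ => 1 + |x|) atTop atTop)).const_mul C
    simpa using this

theorem mittagLefflerKernel_eq_integral_re_eq_two {α t : ℝ} (hα : α ∈ Ioo (1 : ℝ) 2)
    (ht : 0 < t) :
    (mittagLefflerKernel α t : ℂ) = (1 / (2 * π) : ℝ) *
      ∫ y : ℝ, Complex.exp ((2 + y * Complex.I) * t) *
        (1 + (2 + y * Complex.I) ^ (α : ℂ))⁻¹ := by
  set f : ℝ → ℂ := indicator (Ioi 0)
    fun t => Complex.exp (-(2 * t)) * (mittagLefflerKernel α t : ℂ) with hf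
  set H : ℝ → ℂ := fun y => (1 + (2 + y * Complex.I) ^ (α : ℂ))⁻¹ with hH
  have hfi : Integrable f := by
    rw [hf, integrable_indicator_iff measurableSet_Ioi]
    refine (integrableOn_exp_mul_mittagLefflerKernel hα.1).ofReal.congr
      (Eventually.of_forall fun t => ?_)
    simp
  have hF : 𝓕 f = fun w => H (2 * π * w) := by
    funext w
    rw [fourier_real_eq_integral_exp_smul, hH]
    simp only
    rw [← integral_cexp_mul_mittagLefflerKernel hα.1 (by simp), ← integral_indicator
      measurableSet_Ioi]
    refine integral_congr_ae (Eventually.of_forall fun t => ?_)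
    simp only [hf, indicator]
    split_ifs
    · rw [smul_eq_mul, ← mul_assoc, ← Complex.exp_add]
      congr 2
      push_cast; ring
    · simp
  have hHi : Integrable H := by
    obtain ⟨hB, -, -⟩ := integrable_one_add_abs_rpow_neg hα.1 (2 * (cos (α * (π / 2) / 2))⁻¹)
    refine hB.mono' (Continuous.aestronglyMeasurable ?_) (Eventually.of_forall fun y => ?_)
    · rw [hH]
      refine Continuous.inv₀ ?_ fun y => (norm_inv_one_add_cpow_le hα (by simp)).1
      refine continuous_const.add (Continuous.cpow (by fun_prop) continuous_const fun y => ?_)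
      left; simp
    · exact (norm_inv_one_add_cpow_le hα (by simp)).2.trans_eq (by simp)
  have hinv := hfi.fourierInv_fourier_eq (v := t) ?_ ?_
  · rw [fourierInv_eq', hF, hf, indicator_of_mem (show t ∈ Ioi 0 from ht)] at hinv
    have hsub := Measure.integral_comp_mul_left
      (fun y : ℝ => Complex.exp (y * t * Complex.I) * H y) (2 * π)
    have h1 : ∀ v : ℝ, Complex.exp (((2 * π * inner ℝ v t : ℝ) : ℂ) * Complex.I) • H (2 * π * v)
        = Complex.exp (((2 * π * v : ℝ) : ℂ) * t * Complex.I) * H (2 * π * v) := by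
      intro v
      rw [smul_eq_mul]
      congr 2
      simp; ring
    simp only [h1] at hinv
    rw [hsub] at hinv
    have h2 : ∀ y : ℝ, Complex.exp ((2 + y * Complex.I) * t) * (1 + (2 + y * Complex.I) ^ (α : ℂ))⁻¹
        = Complex.exp (2 * t) * (Complex.exp (y * t * Complex.I) * H y) := by
      intro y
      rw [← mul_assoc, ← Complex.exp_add, hH]
      congr 2; ring
    simp only [h2]
    rw [integral_const_mul, mul_left_comm, ← Complex.real_smul]
    rw [abs_of_pos (by positivity), ← one_div] at hinv
    rw [hinv, ← mul_assoc, ← Complex.exp_add]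
    simp
  · rw [hF]
    exact hHi.comp_mul_left' (by positivity)
  · have : ContinuousOn f (Ioi 0) := by
      rw [hf]
      refine ContinuousOn.congr (f := fun t : ℝ =>
        Complex.exp (-(2 * t)) * (mittagLefflerKernel α t : ℂ)) ?_ fun x hx => indicator_of_mem hx _
      refine (Continuous.continuousOn (by fun_prop)).mul ?_
      exact Complex.continuous_ofReal.comp_continuousOn (continuousOn_mittagLefflerKernel hα.1)
    exact this.continuousAt (Ioi_mem_nhds ht)

theorem mittagLefflerKernel_eq_integral_imaginary_axis {α t : ℝ} (hα : α ∈ Ioo (1 : ℝ) 2)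
    (ht : 0 < t) :
    (mittagLefflerKernel α t : ℂ) = (1 / (2 * π) : ℝ) *
      ∫ y : ℝ, Complex.exp (y * Complex.I * t) * (1 + (y * Complex.I) ^ (α : ℂ))⁻¹ := by
  set f : ℂ → ℂ := fun w => Complex.exp (w * Complex.I * t) *
    (1 + (w * Complex.I) ^ (α : ℂ))⁻¹ with hf
  obtain ⟨hB, hbot, htop⟩ := integrable_one_add_abs_rpow_neg hα.1
    (exp (2 * t) * (2 * (cos (α * (π / 2) / 2))⁻¹))
  have hα0 : 0 < α := by linarith [hα.1]
  have hre : ∀ w : ℂ, w.im ≤ 0 → 0 ≤ (w * Complex.I).re := fun w hw => by simpa using hw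
  have hstrip := integral_horizontal_line_eq (f := f) (a := -2) (b := 0) ?_ ?_ hB hbot htop ?_
  · rw [mittagLefflerKernel_eq_integral_re_eq_two hα ht]
    congr 1
    convert hstrip using 3 with x x
    · rw [hf]
      simp only
      rw [show (x + ((-2 : ℝ) : ℂ) * Complex.I) * Complex.I = 2 + x * Complex.I by
        push_cast; ring_nf; simp; ring]
    · simp [hf]
  · rw [uIcc_of_le (by norm_num)]
    intro w hw
    have hw0 := hre w hw.2
    refine ContinuousAt.continuousWithinAt ?_
    have h1 : ContinuousAt (fun w : ℂ => w * Complex.I) w := by fun_prop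
    have h2 : ContinuousAt (fun w : ℂ => (w * Complex.I) ^ (α : ℂ)) w :=
      ContinuousAt.comp (f := fun w : ℂ => w * Complex.I) (g := fun z => z ^ (α : ℂ))
        (Complex.continuousAt_cpow_const_of_re_pos (Or.inl hw0) (by simpa using hα0)) h1
    exact ContinuousAt.mul (by fun_prop)
      ((continuousAt_const.add h2).inv₀ (norm_inv_one_add_cpow_le hα hw0).1)
  · rw [min_eq_left (by norm_num), max_eq_right (by norm_num)]
    intro w hw
    have hw0 := hre w hw.2.le
    refine DifferentiableAt.differentiableWithinAt ?_
    have h2 : DifferentiableAt ℂ (fun w : ℂ => (w * Complex.I) ^ (α : ℂ)) w := by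
      refine DifferentiableAt.cpow_const (by fun_prop) (Or.inl ?_)
      simpa using hw.2
    exact DifferentiableAt.mul (by fun_prop)
      ((h2.const_add 1).inv (norm_inv_one_add_cpow_le hα hw0).1)
  · rw [uIcc_of_le (by norm_num)]
    intro w hw
    rw [hf]
    simp only
    rw [norm_mul, mul_assoc (exp _)]
    refine mul_le_mul ?_ ((norm_inv_one_add_cpow_le hα (hre w hw.2)).2.trans_eq (by simp))
      (norm_nonneg _) (exp_pos _).le
    rw [Complex.norm_exp, exp_le_exp]
    have := hw.1
    simp
    nlinarith

theorem mittagLefflerKernel_eq_integral_half_pi {α t : ℝ} (hα : α ∈ Ioo (1 : ℝ) 2) (ht : 0 < t) :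
    mittagLefflerKernel α t = 1 / π * (∫ x : ℝ,
      Complex.exp (x + (π / 2 : ℝ) * Complex.I) *
        Complex.exp (t * Complex.exp (x + (π / 2 : ℝ) * Complex.I)) *
        (1 + Complex.exp (α * (x + (π / 2 : ℝ) * Complex.I)))⁻¹).im := by
  set g : ℝ → ℂ := fun y => Complex.exp (y * Complex.I * t) *
    (1 + (y * Complex.I) ^ (α : ℂ))⁻¹ with hg
  have hα0 : 0 < α := by linarith [hα.1]
  have hgi : Integrable g := by
    obtain ⟨hB, -, -⟩ := integrable_one_add_abs_rpow_neg hα.1 (2 * (cos (α * (π / 2) / 2))⁻¹)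
    refine hB.mono' (Continuous.aestronglyMeasurable ?_) (Eventually.of_forall fun y => ?_)
    · have h2 : Continuous (fun y : ℝ => ((y : ℂ) * Complex.I) ^ (α : ℂ)) := by
        refine continuous_iff_continuousAt.2 fun y => ?_
        exact ContinuousAt.comp (f := fun y : ℝ => (y : ℂ) * Complex.I)
          (g := fun z => z ^ (α : ℂ))
          (Complex.continuousAt_cpow_const_of_re_pos (Or.inl (by simp)) (by simpa using hα0))
          (by fun_prop)
      exact Continuous.mul (by fun_prop)
        ((continuous_const.add h2).inv₀ fun y => (norm_inv_one_add_cpow_le hα (by simp)).1)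
    · rw [hg]
      simp only
      rw [norm_mul, Complex.norm_exp]
      refine le_trans (le_of_eq ?_)
        ((norm_inv_one_add_cpow_le hα (by simp) (l := y * Complex.I)).2.trans_eq (by simp))
      simp
  have hconj : ∀ y : ℝ, (g (-y)).re = (g y).re := by
    intro y
    have : g (-y) = (starRingEnd ℂ) (g y) := by
      rw [hg]
      have h3 : (starRingEnd ℂ) ((y : ℂ) * Complex.I) = (((-y : ℝ)) : ℂ) * Complex.I := by
        simp
      simp only [map_mul, map_inv₀, map_add, map_one]
      have h4 := Complex.conj_cpow ((y : ℂ) * Complex.I) (α : ℂ) (by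
        rw [Ne, Complex.arg_eq_pi_iff]; simp)
      rw [Complex.conj_ofReal] at h4
      rw [← h4, h3, ← Complex.exp_conj, map_mul, h3, Complex.conj_ofReal]
    rw [this, Complex.conj_re]
  have heven : ∀ᵐ y : ℝ, (g y).re = (g |y|).re := by
    refine Eventually.of_forall fun y => ?_
    rcases abs_choice y with h | h
    · rw [h]
    · rw [h, hconj]
  have hmain : mittagLefflerKernel α t = 1 / π * (∫ y in Ioi (0 : ℝ), g y).re := by
    have h := congrArg Complex.re (mittagLefflerKernel_eq_integral_imaginary_axis hα ht)
    rw [Complex.ofReal_re, Complex.re_ofReal_mul] at h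
    change _ = _ * (RCLike.re (K := ℂ) _) at h
    rw [← integral_re hgi] at h
    change _ = _ * ∫ y, (g y).re at h
    rw [integral_congr_ae heven, integral_comp_abs (f := fun y => (g y).re)] at h
    rw [h]
    change _ = _ * (RCLike.re (K := ℂ) _)
    rw [← integral_re hgi.integrableOn]
    change _ = _ * ∫ y in Ioi 0, (g y).re
    field_simp
  rw [hmain, setIntegral_Ioi_eq_integral_exp]
  have h5 : ∀ x : ℝ, exp x • g (exp x) = -Complex.I * (Complex.exp (x + (π / 2 : ℝ) * Complex.I) *
        Complex.exp (t * Complex.exp (x + (π / 2 : ℝ) * Complex.I)) *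
        (1 + Complex.exp (α * (x + (π / 2 : ℝ) * Complex.I)))⁻¹) := by
    intro x
    have hE : Complex.exp (x + (π / 2 : ℝ) * Complex.I) = exp x * Complex.I := by
      rw [Complex.exp_add, Complex.ofReal_div, Complex.ofReal_ofNat, Complex.exp_pi_div_two_mul_I,
        Complex.ofReal_exp]
    have hL : Complex.log (exp x * Complex.I) = x + (π / 2 : ℝ) * Complex.I := by
      rw [← hE, Complex.log_exp] <;> simp <;> linarith [pi_pos]
    have h0 : (exp x * Complex.I : ℂ) ≠ 0 := by rw [← hE]; exact Complex.exp_ne_zero _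
    rw [hg, hE]
    simp only
    rw [Complex.cpow_def_of_ne_zero h0, hL, Complex.real_smul, mul_comm (t : ℂ),
      mul_comm (α : ℂ)]
    linear_combination (exp x : ℂ) * Complex.exp (exp x * Complex.I * t) *
      (1 + Complex.exp ((x + (π / 2 : ℝ) * Complex.I) * α))⁻¹ * Complex.I_mul_I
  simp only [h5]
  rw [integral_const_mul]
  simp

theorem integral_exp_mul_exp_neg_mul_exp {a c : ℝ} (ha : 0 < a) (hc : 0 < c) :
    Integrable (fun x : ℝ => exp (a * x) * exp (-(c * exp x))) ∧
      ∫ x : ℝ, exp (a * x) * exp (-(c * exp x)) = (1 / c) ^ a * Gamma a := by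
  have h : ∀ x : ℝ, exp (a * x) * exp (-(c * exp x))
      = exp x • (exp x ^ (a - 1) * exp (-(c * exp x))) := by
    intro x
    rw [smul_eq_mul, ← exp_mul, show exp (a * x) = exp x * exp (x * (a - 1)) by
      rw [← exp_add]; ring_nf, mul_assoc]
  simp only [h]
  rw [← integrableOn_Ioi_iff_integrable_exp (fun q => q ^ (a - 1) * exp (-(c * q))),
    ← setIntegral_Ioi_eq_integral_exp (fun q => q ^ (a - 1) * exp (-(c * q)))]
  refine ⟨?_, integral_rpow_mul_exp_neg_mul_Ioi ha hc⟩
  have := integrableOn_rpow_mul_exp_neg_mul_rpow (s := a - 1) (p := 1) (b := c)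
      (by linarith) one_pos hc
  simpa using this

theorem norm_cexp_mul_cexp (t x η : ℝ) :
    ‖Complex.exp (t * Complex.exp (x + η * Complex.I))‖ = exp (t * cos η * exp x) := by
  rw [Complex.norm_exp, Complex.re_ofReal_mul, Complex.exp_re]
  congr 1
  simp; ring

theorem integral_cexp_mul_cexp_mul_cexp {t η : ℝ} (ht : 0 < t) (h1 : π / 2 < η) (h2 : η < π) :
    ∫ x : ℝ, Complex.exp (x + η * Complex.I) * Complex.exp (t * Complex.exp (x + η * Complex.I))
      = ((-t⁻¹ : ℝ) : ℂ) := by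
  set w : ℂ := (log t : ℝ) + (η - π : ℝ) * Complex.I with hw
  have h3 := integral_rpow_mul_cexp_neg_mul_cexp (z := 1) (w := w) one_pos
    (by rw [hw]; simp only [Complex.add_im, Complex.ofReal_im, Complex.im_ofReal_mul,
          Complex.I_im, mul_one, zero_add]; rw [abs_lt]; constructor <;> linarith)
  rw [setIntegral_Ioi_eq_integral_exp] at h3
  have h4 : Complex.exp w = -(t * Complex.exp (η * Complex.I)) := by
    rw [hw, Complex.exp_add, ← Complex.ofReal_exp, exp_log ht, Complex.ofReal_sub, sub_mul,
      Complex.exp_sub, Complex.exp_pi_mul_I]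
    ring
  have h5 : ∀ x : ℝ, Complex.exp (x + η * Complex.I) *
      Complex.exp (t * Complex.exp (x + η * Complex.I)) = Complex.exp (η * Complex.I) *
      (exp x • (((exp x ^ (1 - 1 : ℝ) : ℝ) : ℂ) * Complex.exp (-(exp x * Complex.exp w)))) := by
    intro x
    rw [h4, Complex.exp_add, Complex.real_smul]
    simp only [sub_self, rpow_zero, Complex.ofReal_one, one_mul, Complex.ofReal_exp]
    ring_nf
  simp only [h5]
  rw [integral_const_mul, h3, Complex.ofReal_one, one_mul, Complex.exp_neg, h4, Gamma_one]
  have := Complex.exp_ne_zero (η * Complex.I)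
  have : (t : ℂ) ≠ 0 := by exact_mod_cast ht.ne'
  push_cast
  field_simp

theorem norm_inv_one_add_cexp_mul_le {α η : ℝ} (hα : 1 < α) (h1 : π / 2 < η) (h2 : η < π / α)
    {w : ℂ} (hw : w.im ∈ Icc (π / 2) η) :
    1 + Complex.exp (α * w) ≠ 0 ∧ ‖(1 + Complex.exp (α * w))⁻¹‖
      ≤ (cos (α * η / 2))⁻¹ / (1 + exp (α * w.re)) ∧ 0 < (cos (α * η / 2))⁻¹ := by
  have hα0 : 0 < α := by linarith
  have h3 : α * η < π := by rw [mul_comm]; exact (lt_div_iff₀ hα0).1 h2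
  have h4 : |(α * w).im| ≤ α * η := by
    rw [Complex.im_ofReal_mul, abs_mul, abs_of_pos hα0,
      abs_of_nonneg ((by positivity : 0 ≤ π / 2).trans hw.1)]
    exact mul_le_mul_of_nonneg_left hw.2 hα0.le
  refine ⟨one_add_cexp_ne_zero (h4.trans_lt h3), ?_, ?_⟩
  · have := norm_inv_one_add_cexp_le h4 h3
    rwa [Complex.re_ofReal_mul] at this
  · have : 0 < α * η := mul_pos hα0 (by linarith [pi_pos])
    exact inv_pos.2 (cos_pos_of_mem_Ioo ⟨by linarith, by linarith⟩)

theorem norm_contour_integrand_le {α η t : ℝ} (hα : 1 < α) (h1 : π / 2 < η) (h2 : η < π / α)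
    (x : ℝ) :
    ‖Complex.exp ((1 + α) * (x + η * Complex.I)) *
      Complex.exp (t * Complex.exp (x + η * Complex.I)) *
      (1 + Complex.exp (α * (x + η * Complex.I)))⁻¹‖
    ≤ (cos (α * η / 2))⁻¹ * (exp ((1 + α) * x) * exp (t * cos η * exp x)
        / (1 + exp (α * x))) := by
  obtain ⟨-, h3, h4⟩ := norm_inv_one_add_cexp_mul_le hα h1 h2 (w := x + η * Complex.I)
    (by simp [h1.le])
  rw [norm_mul, norm_mul, norm_cexp_mul_cexp, mul_comm, Complex.norm_exp]
  have h5 : ((1 + α) * (x + η * Complex.I) : ℂ).re = (1 + α) * x := by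
    rw [show (1 + α : ℂ) = ((1 + α : ℝ) : ℂ) by push_cast; rfl, Complex.re_ofReal_mul]; simp
  rw [h5]
  simp only [Complex.add_re, Complex.ofReal_re, Complex.mul_re, Complex.I_re, mul_zero,
    Complex.ofReal_im, Complex.I_im, sub_self, mul_one, add_zero] at h3
  refine (mul_le_mul_of_nonneg_right h3 (by positivity)).trans_eq ?_
  ring

theorem cos_neg_of_half_pi_lt {α η : ℝ} (hα : 1 < α) (h1 : π / 2 < η) (h2 : η ≤ π / α) :
    cos η < 0 := by
  have : π / α < π := div_lt_self pi_pos hα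
  exact cos_neg_of_pi_div_two_lt_of_lt h1 (by linarith)

theorem integrable_contour_integrand {α η t : ℝ} (hα : 1 < α) (h1 : π / 2 < η) (h2 : η < π / α)
    (ht : 0 < t) :
    Integrable fun x : ℝ => Complex.exp ((1 + α) * (x + η * Complex.I)) *
      Complex.exp (t * Complex.exp (x + η * Complex.I)) *
      (1 + Complex.exp (α * (x + η * Complex.I)))⁻¹ := by
  have hcos := cos_neg_of_half_pi_lt hα h1 h2.le
  have hc : 0 < -(t * cos η) := by nlinarith
  obtain ⟨hi, -⟩ := integral_exp_mul_exp_neg_mul_exp (a := 1 + α) (by linarith) hc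
  obtain ⟨-, -, hK⟩ := norm_inv_one_add_cexp_mul_le hα h1 h2 (w := η * Complex.I) (by simp [h1.le])
  refine (hi.const_mul (cos (α * η / 2))⁻¹).mono' (Continuous.aestronglyMeasurable ?_)
    (Eventually.of_forall fun x => (norm_contour_integrand_le hα h1 h2 x).trans ?_)
  · exact Continuous.mul (by fun_prop) (Continuous.inv₀ (by fun_prop) fun x =>
      (norm_inv_one_add_cexp_mul_le hα h1 h2 (by simp [h1.le])).1)
  · refine mul_le_mul_of_nonneg_left ((div_le_self (by positivity) ?_).trans_eq ?_) hK.le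
    · linarith [exp_pos (α * x)]
    · simp

theorem mittagLefflerKernel_eq_contour {α η t : ℝ} (hα : α ∈ Ioo (1 : ℝ) 2) (h1 : π / 2 < η)
    (h2 : η < π / α) (ht : 0 < t) :
    mittagLefflerKernel α t = -(1 / π) * (∫ x : ℝ,
      Complex.exp ((1 + α) * (x + η * Complex.I)) *
      Complex.exp (t * Complex.exp (x + η * Complex.I)) *
      (1 + Complex.exp (α * (x + η * Complex.I)))⁻¹).im := by
  have hα0 : 0 < α := by linarith [hα.1]
  have hπ : π / α < π := div_lt_self pi_pos hα.1
  set f : ℂ → ℂ := fun w => Complex.exp w * Complex.exp (t * Complex.exp w) *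
    (1 + Complex.exp (α * w))⁻¹ with hf
  obtain ⟨-, -, hK⟩ := norm_inv_one_add_cexp_mul_le hα.1 h1 h2 (w := η * Complex.I)
    (by simp [h1.le])
  obtain ⟨hB, hbot, htop⟩ := integrable_exp_div_one_add_exp one_pos hα.1 (cos (α * η / 2))⁻¹ hK.le
  have hbound : ∀ w : ℂ, w.im ∈ Icc (π / 2) η → ‖f w‖ ≤
      (cos (α * η / 2))⁻¹ * exp (1 * w.re) / (1 + exp (α * w.re)) := by
    intro w hw
    obtain ⟨-, h3, -⟩ := norm_inv_one_add_cexp_mul_le hα.1 h1 h2 hw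
    rw [hf]
    simp only
    rw [norm_mul, norm_mul, Complex.norm_exp]
    have h4 : ‖Complex.exp (t * Complex.exp w)‖ ≤ 1 := by
      rw [Complex.norm_exp, exp_le_one_iff, Complex.re_ofReal_mul, Complex.exp_re]
      have : cos w.im ≤ 0 := cos_nonpos_of_pi_div_two_le_of_le hw.1 (by linarith [hw.2])
      have := mul_nonneg ht.le (exp_pos w.re).le
      nlinarith
    calc exp w.re * ‖Complex.exp (t * Complex.exp w)‖ * ‖(1 + Complex.exp (α * w))⁻¹‖
        ≤ exp w.re * 1 * ((cos (α * η / 2))⁻¹ / (1 + exp (α * w.re))) := by gcongr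
      _ = _ := by rw [one_mul]; ring
  have hcont : ContinuousOn f {w | w.im ∈ Icc (π / 2) η} := fun w hw =>
    (ContinuousAt.mul (by fun_prop) (ContinuousAt.inv₀
      (by fun_prop : ContinuousAt (fun w : ℂ => 1 + Complex.exp (α * w)) w)
      (norm_inv_one_add_cexp_mul_le hα.1 h1 h2 hw).1)).continuousWithinAt
  have hstrip := integral_horizontal_line_eq (f := f) (a := π / 2) (b := η)
    (by rwa [uIcc_of_le h1.le]) ?_ hB hbot htop (by rwa [uIcc_of_le h1.le])
  · rw [mittagLefflerKernel_eq_integral_half_pi hα ht]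
    change 1 / π * (∫ x : ℝ, f (x + (π / 2 : ℝ) * Complex.I)).im = _
    rw [hstrip]
    have hi := integrable_contour_integrand hα.1 h1 h2 ht
    have hfi : Integrable fun x : ℝ => f (x + η * Complex.I) := by
      refine hB.mono' (Continuous.aestronglyMeasurable ?_) (Eventually.of_forall fun x => ?_)
      · exact hcont.comp_continuous (by fun_prop) (fun x => by simp [h1.le])
      · simpa using hbound (x + η * Complex.I) (by simp [h1.le])
    have hadd := integral_add hfi hi
    have h6 : ∀ x : ℝ, f (x + η * Complex.I) + Complex.exp ((1 + α) * (x + η * Complex.I)) *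
      Complex.exp (t * Complex.exp (x + η * Complex.I)) *
      (1 + Complex.exp (α * (x + η * Complex.I)))⁻¹ = Complex.exp (x + η * Complex.I) *
        Complex.exp (t * Complex.exp (x + η * Complex.I)) := by
      intro x
      have h7 := (norm_inv_one_add_cexp_mul_le hα.1 h1 h2 (w := x + η * Complex.I)
        (by simp [h1.le])).1
      rw [hf]
      simp only
      rw [show (1 + α) * (x + η * Complex.I) = (x + η * Complex.I) + α * (x + η * Complex.I) by
        ring, Complex.exp_add (x + η * Complex.I) (α * _)]
      linear_combination Complex.exp (x + η * Complex.I) *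
        Complex.exp (t * Complex.exp (x + η * Complex.I)) * mul_inv_cancel₀ h7
    simp only [h6] at hadd
    rw [integral_cexp_mul_cexp_mul_cexp ht h1 (h2.trans hπ)] at hadd
    have h8 := congrArg Complex.im hadd
    rw [Complex.ofReal_im, Complex.add_im] at h8
    linear_combination (-1 / π) * h8
  · rw [min_eq_left h1.le, max_eq_right h1.le]
    intro w hw
    exact (DifferentiableAt.mul (by fun_prop) (DifferentiableAt.inv
      (by fun_prop : DifferentiableAt ℂ (fun w : ℂ => 1 + Complex.exp (α * w)) w)
      (norm_inv_one_add_cexp_mul_le hα.1 h1 h2 ⟨hw.1.le, hw.2.le⟩).1)).differentiableWithinAt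

theorem abs_mittagLefflerKernel_le_rpow_neg {α : ℝ} (hα : α ∈ Ioo (1 : ℝ) 2) :
    ∃ C : ℝ, 0 ≤ C ∧ ∀ t : ℝ, 0 < t → |mittagLefflerKernel α t| ≤ C * t ^ (-(1 + α)) := by
  obtain ⟨h3, h4⟩ := hα
  have hφ : π / 2 < π / α := by gcongr
  obtain ⟨η, h1, h2⟩ := exists_between hφ
  have hcos := cos_neg_of_half_pi_lt h3 h1 h2.le
  obtain ⟨-, -, hK⟩ := norm_inv_one_add_cexp_mul_le h3 h1 h2 (w := η * Complex.I) (by simp [h1.le])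
  have hG := Gamma_pos_of_pos (show 0 < 1 + α by linarith)
  refine ⟨1 / π * ((cos (α * η / 2))⁻¹ * ((1 / -cos η) ^ (1 + α) * Gamma (1 + α))), ?_,
    fun t ht => ?_⟩
  · have : 0 < -cos η := by linarith
    positivity
  have hc : 0 < -(t * cos η) := by nlinarith
  obtain ⟨hi, hI⟩ := integral_exp_mul_exp_neg_mul_exp (a := 1 + α) (by linarith) hc
  rw [mittagLefflerKernel_eq_contour ⟨h3, h4⟩ h1 h2 ht, abs_mul, abs_neg,
    abs_of_pos (by positivity : 0 < 1 / π), mul_assoc]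
  refine mul_le_mul_of_nonneg_left ?_ (by positivity)
  refine (Complex.abs_im_le_norm _).trans ?_
  have h5 : (1 / -(t * cos η)) ^ (1 + α) = (1 / -cos η) ^ (1 + α) * t ^ (-(1 + α)) := by
    rw [rpow_neg ht.le, ← inv_rpow ht.le, ← mul_rpow _ (by positivity)]
    · congr 1
      have := hcos.ne
      field_simp
    · have : 0 < -cos η := by linarith
      positivity
  calc _ ≤ ∫ x : ℝ, (cos (α * η / 2))⁻¹ * (exp ((1 + α) * x) * exp (-(-(t * cos η) * exp x))) := by
        refine norm_integral_le_of_norm_le (hi.const_mul _) (Eventually.of_forall fun x => ?_)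
        refine (norm_contour_integrand_le h3 h1 h2 x).trans ?_
        refine mul_le_mul_of_nonneg_left ((div_le_self (by positivity) ?_).trans_eq ?_) hK.le
        · linarith [exp_pos (α * x)]
        · simp
    _ = _ := by
        rw [integral_const_mul, hI, h5]; ring

theorem integral_cexp_div_one_add_cexp_mul {α b η : ℝ} (hα : 0 < α) (hb : 0 < b) (hbα : b < α)
    (hη : |α * η| < π) :
    ∫ x : ℝ, Complex.exp (b * (x + η * Complex.I)) *
        (1 + Complex.exp (α * (x + η * Complex.I)))⁻¹
      = ((π / (α * sin (π * (b / α))) : ℝ) : ℂ) := by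
  have h := integral_cexp_div_one_add_cexp (a := b / α) (by positivity)
    ((div_lt_one hα).2 hbα) hη
  have hsub := Measure.integral_comp_mul_left (fun y : ℝ =>
    Complex.exp ((b / α : ℝ) * (y + (α * η : ℝ) * Complex.I)) /
      (1 + Complex.exp (y + (α * η : ℝ) * Complex.I))) α
  rw [h] at hsub
  have hα' : (α : ℂ) ≠ 0 := by exact_mod_cast hα.ne'
  convert hsub using 1
  · congr 1
    funext x
    rw [div_eq_mul_inv, show ((b / α : ℝ) : ℂ) * (((α * x : ℝ) : ℂ) + (α * η : ℝ) * Complex.I)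
      = b * (x + η * Complex.I) by push_cast; field_simp,
      show (((α * x : ℝ) : ℂ) + (α * η : ℝ) * Complex.I) = α * (x + η * Complex.I) by
        push_cast; ring]
  · rw [abs_of_pos (inv_pos.2 hα), Complex.real_smul]
    push_cast
    field_simp

theorem integrable_mellin_contour {α η z : ℝ} (hα : 1 < α) (h1 : π / 2 < η) (h2 : η < π / α)
    (hz1 : 1 < z) (hz2 : z < 1 + α) :
    Integrable (Function.uncurry fun t x : ℝ => ((t ^ (z - 1) : ℝ) : ℂ) *
      (Complex.exp ((1 + α) * (x + η * Complex.I)) *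
      Complex.exp (t * Complex.exp (x + η * Complex.I)) *
      (1 + Complex.exp (α * (x + η * Complex.I)))⁻¹))
      ((volume.restrict (Ioi 0)).prod volume) := by
  have hcos := cos_neg_of_half_pi_lt hα h1 h2.le
  have hc : 0 < -cos η := by linarith
  have hz0 : 0 < z := by linarith
  have hα0 : 0 < α := by linarith
  obtain ⟨-, -, hK⟩ := norm_inv_one_add_cexp_mul_le hα h1 h2 (w := η * Complex.I) (by simp [h1.le])
  have hm : Measurable (Function.uncurry fun t x : ℝ => ((t ^ (z - 1) : ℝ) : ℂ) *
      (Complex.exp ((1 + α) * (x + η * Complex.I)) *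
      Complex.exp (t * Complex.exp (x + η * Complex.I)) *
      (1 + Complex.exp (α * (x + η * Complex.I)))⁻¹)) := by
    unfold Function.uncurry; fun_prop
  have hnorm : ∀ x : ℝ, ∀ t ∈ Ioi (0 : ℝ), ‖((t ^ (z - 1) : ℝ) : ℂ) *
      (Complex.exp ((1 + α) * (x + η * Complex.I)) *
      Complex.exp (t * Complex.exp (x + η * Complex.I)) *
      (1 + Complex.exp (α * (x + η * Complex.I)))⁻¹)‖ =
      (t ^ (z - 1) * exp (-(-cos η * exp x * t))) *
        (‖Complex.exp ((1 + α) * (x + η * Complex.I))‖ *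
          ‖(1 + Complex.exp (α * (x + η * Complex.I)))⁻¹‖) := by
    intro x t (ht : 0 < t)
    rw [norm_mul, norm_mul, norm_mul, norm_cexp_mul_cexp, Complex.norm_real,
      norm_of_nonneg (by positivity)]
    ring_nf
  have hti : ∀ x : ℝ, IntegrableOn (fun t : ℝ => t ^ (z - 1) * exp (-(-cos η * exp x * t)))
      (Ioi 0) := by
    intro x
    have := integrableOn_rpow_mul_exp_neg_mul_rpow (s := z - 1) (p := 1) (b := -cos η * exp x)
      (by linarith) one_pos (by positivity)
    simpa using this
  rw [integrable_prod_iff' hm.aestronglyMeasurable]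
  refine ⟨Eventually.of_forall fun x => ?_, ?_⟩
  · refine ((hti x).mul_const (‖Complex.exp ((1 + α) * (x + η * Complex.I))‖ *
          ‖(1 + Complex.exp (α * (x + η * Complex.I)))⁻¹‖)).mono' ?_ ?_
    · exact (hm.comp (by fun_prop : Measurable fun t : ℝ => (t, x))).aestronglyMeasurable
    · filter_upwards [ae_restrict_mem measurableSet_Ioi] with t ht
      exact (hnorm x t ht).le
  · have hval : ∀ x : ℝ, ∫ t in Ioi (0 : ℝ), ‖Function.uncurry (fun t x : ℝ =>
      ((t ^ (z - 1) : ℝ) : ℂ) * (Complex.exp ((1 + α) * (x + η * Complex.I)) *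
      Complex.exp (t * Complex.exp (x + η * Complex.I)) *
      (1 + Complex.exp (α * (x + η * Complex.I)))⁻¹)) (t, x)‖
        = (1 / (-cos η * exp x)) ^ z * Gamma z *
        (‖Complex.exp ((1 + α) * (x + η * Complex.I))‖ *
          ‖(1 + Complex.exp (α * (x + η * Complex.I)))⁻¹‖) := by
      intro x
      rw [← integral_rpow_mul_exp_neg_mul_Ioi hz0 (by positivity), ← integral_mul_const]
      exact setIntegral_congr_fun measurableSet_Ioi (hnorm x)
    simp only [hval]
    obtain ⟨hB, -, -⟩ := integrable_exp_div_one_add_exp (a := 1 + α - z) (q := α) (by linarith)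
      (by linarith) ((-cos η) ^ (-z) * Gamma z * (cos (α * η / 2))⁻¹) (by
        have := Gamma_pos_of_pos hz0
        positivity)
    refine hB.mono' (Measurable.aestronglyMeasurable (by fun_prop)) (Eventually.of_forall fun x => ?_)
    have hG := Gamma_pos_of_pos hz0
    rw [norm_of_nonneg (by positivity)]
    obtain ⟨-, h3, -⟩ := norm_inv_one_add_cexp_mul_le hα h1 h2 (w := x + η * Complex.I)
      (by simp [h1.le])
    have h5 : ((1 + α) * (x + η * Complex.I) : ℂ).re = (1 + α) * x := by
      rw [show (1 + α : ℂ) = ((1 + α : ℝ) : ℂ) by push_cast; rfl, Complex.re_ofReal_mul]; simp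
    have h6 : (1 / (-cos η * exp x)) ^ z = (-cos η) ^ (-z) * exp (-(z * x)) := by
      rw [one_div, inv_rpow (by positivity), mul_rpow hc.le (exp_pos _).le, ← exp_mul, mul_inv,
        rpow_neg hc.le, exp_neg, mul_comm x]
    rw [Complex.norm_exp, h5, h6]
    simp only [Complex.add_re, Complex.ofReal_re, Complex.mul_re, Complex.I_re, mul_zero,
      Complex.ofReal_im, Complex.I_im, sub_self, mul_one, add_zero] at h3
    calc _ ≤ (-cos η) ^ (-z) * exp (-(z * x)) * Gamma z * (exp ((1 + α) * x) *
          ((cos (α * η / 2))⁻¹ / (1 + exp (α * x)))) := by gcongr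
      _ = _ := by
        rw [show exp ((1 + α - z) * x) = exp (-(z * x)) * exp ((1 + α) * x) by
          rw [← exp_add]; ring_nf]
        ring

theorem integral_rpow_mul_mittagLefflerKernel {α z : ℝ} (hα : α ∈ Ioo (1 : ℝ) 2)
    (hz1 : 1 < z) (hz2 : z < 1 + α) :
    ∫ t in Ioi (0 : ℝ), t ^ (z - 1) * mittagLefflerKernel α t
      = Gamma z * sin (π * z) / (α * sin (π * (1 - z) / α)) := by
  obtain ⟨h3, h4⟩ := hα
  have hφ : π / 2 < π / α := by gcongr
  obtain ⟨η, h1, h2⟩ := exists_between hφ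
  have hα0 : 0 < α := by linarith
  have hz0 : 0 < z := by linarith
  have hπ : π / α < π := div_lt_self pi_pos h3
  have hη0 : 0 < η := by linarith [pi_pos]
  have hprod := integrable_mellin_contour h3 h1 h2 hz1 hz2
  have hswap := integral_integral_swap hprod
  have hinner : ∀ x : ℝ, ∫ t in Ioi (0 : ℝ), ((t ^ (z - 1) : ℝ) : ℂ) *
      (Complex.exp ((1 + α) * (x + η * Complex.I)) *
      Complex.exp (t * Complex.exp (x + η * Complex.I)) *
      (1 + Complex.exp (α * (x + η * Complex.I)))⁻¹) =
      Gamma z * Complex.exp (π * z * Complex.I) *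
      (Complex.exp ((1 + α - z : ℝ) * (x + η * Complex.I)) *
        (1 + Complex.exp (α * (x + η * Complex.I)))⁻¹) := by
    intro x
    have h := integral_rpow_mul_cexp_neg_mul_cexp (z := z) (w := x + (η - π : ℝ) * Complex.I) hz0
      (by simp only [Complex.add_im, Complex.ofReal_im, Complex.im_ofReal_mul,
          Complex.I_im, mul_one, zero_add]; rw [abs_lt]; constructor <;> linarith)
    have h4 : Complex.exp (x + (η - π : ℝ) * Complex.I) = -Complex.exp (x + η * Complex.I) := by
      rw [Complex.ofReal_sub, sub_mul, ← add_sub_assoc, Complex.exp_sub, Complex.exp_pi_mul_I]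
      ring
    simp only [h4, mul_neg, neg_neg] at h
    have h5 : ∀ t : ℝ, ((t ^ (z - 1) : ℝ) : ℂ) *
      (Complex.exp ((1 + α) * (x + η * Complex.I)) *
      Complex.exp (t * Complex.exp (x + η * Complex.I)) *
      (1 + Complex.exp (α * (x + η * Complex.I)))⁻¹) =
      (Complex.exp ((1 + α) * (x + η * Complex.I)) *
        (1 + Complex.exp (α * (x + η * Complex.I)))⁻¹) *
      (((t ^ (z - 1) : ℝ) : ℂ) * Complex.exp (t * Complex.exp (x + η * Complex.I))) := by
      intro t; ring
    simp only [h5]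
    rw [integral_const_mul, h]
    have h6 : Complex.exp (π * z * Complex.I) *
      Complex.exp ((1 + α - z : ℝ) * (x + η * Complex.I)) =
      Complex.exp ((1 + α) * (x + η * Complex.I)) *
        Complex.exp (-(z * (x + (η - π : ℝ) * Complex.I))) := by
      rw [← Complex.exp_add, ← Complex.exp_add]
      push_cast; ring_nf
    linear_combination (-(Gamma z : ℂ) * (1 + Complex.exp (α * (x + η * Complex.I)))⁻¹) * h6
  have hαη : |α * η| < π := by
    rw [abs_of_pos (by positivity), mul_comm]
    exact (lt_div_iff₀ hα0).1 h2
  simp only [hinner] at hswap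
  rw [integral_const_mul, integral_cexp_div_one_add_cexp_mul hα0 (by linarith) (by linarith)
    hαη] at hswap
  have hout : ∀ t ∈ Ioi (0 : ℝ), t ^ (z - 1) * mittagLefflerKernel α t = -(1 / π) *
      (∫ x : ℝ, ((t ^ (z - 1) : ℝ) : ℂ) *
      (Complex.exp ((1 + α) * (x + η * Complex.I)) *
      Complex.exp (t * Complex.exp (x + η * Complex.I)) *
      (1 + Complex.exp (α * (x + η * Complex.I)))⁻¹)).im := by
    intro t (ht : 0 < t)
    rw [integral_const_mul, Complex.im_ofReal_mul, mittagLefflerKernel_eq_contour ⟨h3, h4⟩ h1 h2 ht]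
    ring
  rw [setIntegral_congr_fun measurableSet_Ioi hout, integral_const_mul]
  have him := integral_im hprod.integral_prod_left
  change ∫ t in Ioi (0 : ℝ), (∫ x : ℝ, ((t ^ (z - 1) : ℝ) : ℂ) *
      (Complex.exp ((1 + α) * (x + η * Complex.I)) *
      Complex.exp (t * Complex.exp (x + η * Complex.I)) *
      (1 + Complex.exp (α * (x + η * Complex.I)))⁻¹)).im = Complex.im (∫ t in Ioi (0 : ℝ),
      (∫ x : ℝ, ((t ^ (z - 1) : ℝ) : ℂ) *
      (Complex.exp ((1 + α) * (x + η * Complex.I)) *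
      Complex.exp (t * Complex.exp (x + η * Complex.I)) *
      (1 + Complex.exp (α * (x + η * Complex.I)))⁻¹))) at him
  rw [him, hswap, Complex.im_mul_ofReal, Complex.im_ofReal_mul, ← Complex.ofReal_mul,
    Complex.exp_ofReal_mul_I_im]
  have h9 : sin (π * ((1 + α - z) / α)) = -sin (π * (1 - z) / α) := by
    rw [← sin_add_pi]
    congr 1
    field_simp; ring
  rw [h9]
  have := pi_pos.ne'
  rw [mul_neg, div_neg]
  field_simp

theorem exp_neg_le_mul_rpow_neg {a y : ℝ} (ha : 0 < a) (hy : 0 < y) :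
    exp (-y) ≤ a ^ a * y ^ (-a) := by
  have h1 : y / a ≤ exp (y / a) := by linarith [add_one_le_exp (y / a)]
  have h2 := rpow_le_rpow (by positivity) h1 ha.le
  rw [← exp_mul, div_mul_cancel₀ _ ha.ne', div_rpow hy.le ha.le] at h2
  rw [exp_neg, rpow_neg hy.le, ← div_eq_mul_inv, inv_le_comm₀ (exp_pos _) (by positivity), inv_div]
  exact h2

theorem abs_mittagLefflerKernel_le_rpow {α t : ℝ} (hα : 1 < α) (ht : 0 < t) (ht1 : t ≤ 1) :
    |mittagLefflerKernel α t| ≤ 3 * exp 3 * t ^ (α - 1) := by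
  have hterm : ∀ n : ℕ,
      ‖(-1 : ℝ) ^ n * (t ^ (α * ((n : ℝ) + 1) - 1) / Gamma (α * ((n : ℝ) + 1)))‖
        ≤ t ^ (α - 1) * exp 3 * (2 / 3) ^ n := by
    intro n
    have h := mittagLefflerKernel_term_le hα zero_le_one n
    have hG := Gamma_pos_of_pos (show 0 < α * ((n : ℝ) + 1) by positivity)
    rw [norm_mul, norm_pow, norm_neg, norm_one, one_pow, one_mul,
      norm_of_nonneg (by positivity)] at h ⊢
    rw [one_rpow] at h
    have h1 : t ^ (α * ((n : ℝ) + 1) - 1) ≤ t ^ (α - 1) := by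
      refine rpow_le_rpow_of_exponent_ge ht ht1 ?_
      have : 0 ≤ α * n := by positivity
      linarith
    calc t ^ (α * ((n : ℝ) + 1) - 1) / Gamma (α * ((n : ℝ) + 1))
        ≤ t ^ (α - 1) / Gamma (α * ((n : ℝ) + 1)) := by gcongr
      _ = t ^ (α - 1) * (1 / Gamma (α * ((n : ℝ) + 1))) := by ring
      _ ≤ t ^ (α - 1) * (exp (3 / 2 * (1 + 1)) * (2 / 3) ^ n) := by gcongr
      _ = _ := by norm_num; ring
  have h := tsum_of_norm_bounded ((hasSum_geometric_of_lt_one (by norm_num)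
    (by norm_num : (2 / 3 : ℝ) < 1)).mul_left _) hterm
  rw [norm_eq_abs] at h
  refine h.trans_eq ?_
  norm_num
  ring

/-- The function whose Laplace transform, in the variable `t ^ α`, is `hittingDensity α`. -/
noncomputable def hittingKernel (α t : ℝ) : ℝ :=
  α * sin (π / α) / π * mittagLefflerKernel α t
    - 1 / π * (exp (t * cos (π / α)) * sin (t * sin (π / α)))

theorem continuousOn_hittingKernel {α : ℝ} (hα : 1 < α) :
    ContinuousOn (hittingKernel α) (Ioi 0) :=
  ((continuousOn_mittagLefflerKernel hα).const_mul _).sub (Continuous.continuousOn (by fun_prop))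

theorem half_pi_lt_pi_div {α : ℝ} (hα : α ∈ Ioo (1 : ℝ) 2) :
    π / 2 < π / α ∧ π / α < π ∧ cos (π / α) < 0 ∧ 0 < sin (π / α) := by
  obtain ⟨h1, h2⟩ := hα
  have h3 : π / 2 < π / α := by gcongr
  have h4 : π / α < π := div_lt_self pi_pos h1
  exact ⟨h3, h4, cos_neg_of_half_pi_lt h1 h3 le_rfl, sin_pos_of_pos_of_lt_pi (by positivity) h4⟩

theorem abs_hittingKernel_le_rpow_neg {α : ℝ} (hα : α ∈ Ioo (1 : ℝ) 2) :
    ∃ C : ℝ, 0 ≤ C ∧ ∀ t : ℝ, 0 < t → |hittingKernel α t| ≤ C * t ^ (-(1 + α)) := by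
  obtain ⟨C, hC, h⟩ := abs_mittagLefflerKernel_le_rpow_neg hα
  obtain ⟨-, -, hcos, hsin⟩ := half_pi_lt_pi_div hα
  have hα0 : 0 < α := by linarith [hα.1]
  have hc : 0 < -cos (π / α) := by linarith
  refine ⟨α * sin (π / α) / π * C + 1 / π * ((1 + α) ^ (1 + α) * (-cos (π / α)) ^ (-(1 + α))),
    by positivity, fun t ht => ?_⟩
  rw [hittingKernel, add_mul]
  refine (abs_sub _ _).trans (add_le_add ?_ ?_)
  · rw [abs_mul, abs_of_pos (by positivity : 0 < α * sin (π / α) / π), mul_assoc _ C]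
    exact mul_le_mul_of_nonneg_left (h t ht) (by positivity)
  · rw [abs_mul, abs_of_pos (by positivity : 0 < 1 / π), mul_assoc (1 / π)]
    refine mul_le_mul_of_nonneg_left ?_ (by positivity)
    rw [abs_mul, abs_of_pos (exp_pos _)]
    have h2 := exp_neg_le_mul_rpow_neg (a := 1 + α) (y := -cos (π / α) * t) (by linarith)
      (by positivity)
    rw [mul_rpow hc.le ht.le, ← mul_assoc] at h2
    refine le_trans (mul_le_of_le_one_right (exp_pos _).le (abs_sin_le_one _)) (le_trans ?_ h2)
    rw [exp_le_exp]; linarith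

theorem abs_hittingKernel_le_rpow {α : ℝ} (hα : α ∈ Ioo (1 : ℝ) 2) :
    ∃ C : ℝ, 0 ≤ C ∧ ∀ t : ℝ, 0 < t → t ≤ 1 → |hittingKernel α t| ≤ C * t ^ (α - 1) := by
  obtain ⟨-, -, hcos, hsin⟩ := half_pi_lt_pi_div hα
  have hα0 : 0 < α := by linarith [hα.1]
  refine ⟨α * sin (π / α) / π * (3 * exp 3) + 1 / π * sin (π / α), by positivity,
    fun t ht ht1 => ?_⟩
  rw [hittingKernel, add_mul]
  refine (abs_sub _ _).trans (add_le_add ?_ ?_)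
  · rw [abs_mul, abs_of_pos (by positivity : 0 < α * sin (π / α) / π), mul_assoc _ (3 * exp 3)]
    exact mul_le_mul_of_nonneg_left (abs_mittagLefflerKernel_le_rpow hα.1 ht ht1) (by positivity)
  · rw [abs_mul, abs_of_pos (by positivity : 0 < 1 / π), mul_assoc (1 / π)]
    refine mul_le_mul_of_nonneg_left ?_ (by positivity)
    rw [abs_mul, abs_of_pos (exp_pos _)]
    have h1 : exp (t * cos (π / α)) ≤ 1 := exp_le_one_iff.2 (by nlinarith)
    have h2 : |sin (t * sin (π / α))| ≤ t * sin (π / α) := by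
      refine (abs_sin_le_abs).trans_eq (abs_of_pos (by positivity))
    have h3 : t ≤ t ^ (α - 1) := by
      simpa using rpow_le_rpow_of_exponent_ge ht ht1 (show α - 1 ≤ 1 by linarith [hα.2])
    calc exp (t * cos (π / α)) * |sin (t * sin (π / α))| ≤ 1 * (t * sin (π / α)) := by gcongr
      _ ≤ 1 * (t ^ (α - 1) * sin (π / α)) := by gcongr
      _ = _ := by ring

theorem integrableOn_rpow_mul_hittingKernel {α z : ℝ} (hα : α ∈ Ioo (1 : ℝ) 2) (hz1 : 1 - α < z)
    (hz2 : z < 1 + α) :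
    IntegrableOn (fun t => t ^ (z - 1) * hittingKernel α t) (Ioi 0) := by
  obtain ⟨C, hC, h⟩ := abs_hittingKernel_le_rpow_neg hα
  obtain ⟨D, hD, h'⟩ := abs_hittingKernel_le_rpow hα
  have hcont : ContinuousOn (fun t => t ^ (z - 1) * hittingKernel α t) (Ioi 0) :=
    (continuousOn_id.rpow_const fun x hx => Or.inl (ne_of_gt hx)).mul
      (continuousOn_hittingKernel hα.1)
  rw [← Ioc_union_Ioi_eq_Ioi zero_le_one]
  refine IntegrableOn.union ?_ ?_
  · have hi : IntegrableOn (fun t : ℝ => D * t ^ (z + α - 2)) (Ioc 0 1) :=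
      ((intervalIntegral.intervalIntegrable_rpow' (by linarith) (a := 0) (b := 1)).1).const_mul D
    refine hi.mono' ((hcont.mono Ioc_subset_Ioi_self).aestronglyMeasurable measurableSet_Ioc) ?_
    filter_upwards [ae_restrict_mem measurableSet_Ioc] with t ht
    have ht0 : 0 < t := ht.1
    rw [norm_mul, norm_of_nonneg (by positivity), norm_eq_abs]
    refine (mul_le_mul_of_nonneg_left (h' t ht.1 ht.2) (by positivity)).trans_eq ?_
    rw [mul_left_comm, ← rpow_add ht0]; ring_nf
  · have hi : IntegrableOn (fun t : ℝ => C * t ^ (z - 2 - α)) (Ioi 1) :=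
      (integrableOn_Ioi_rpow_of_lt (by linarith) one_pos).const_mul C
    refine hi.mono' ((hcont.mono (Ioi_subset_Ioi zero_le_one)).aestronglyMeasurable
      measurableSet_Ioi) ?_
    filter_upwards [ae_restrict_mem measurableSet_Ioi] with t (ht : 1 < t)
    have ht0 : 0 < t := by linarith
    rw [norm_mul, norm_of_nonneg (by positivity), norm_eq_abs]
    refine (mul_le_mul_of_nonneg_left (h t ht0) (by positivity)).trans_eq ?_
    rw [mul_left_comm, ← rpow_add ht0]; ring_nf

theorem integral_rpow_mul_exp_cos_mul_sin {z θ : ℝ} (hz : 0 < z) (h1 : π / 2 < θ) (h2 : θ < π) :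
    IntegrableOn (fun t => t ^ (z - 1) * (exp (t * cos θ) * sin (t * sin θ))) (Ioi 0) ∧
    ∫ t in Ioi (0 : ℝ), t ^ (z - 1) * (exp (t * cos θ) * sin (t * sin θ))
      = Gamma z * sin ((π - θ) * z) := by
  have hcos : cos θ < 0 := cos_neg_of_pi_div_two_lt_of_lt h1 (by linarith)
  have h := integral_rpow_mul_cexp_neg_mul_cexp (z := z) (w := (θ - π : ℝ) * Complex.I) hz
    (by rw [Complex.im_ofReal_mul, Complex.I_im, mul_one, abs_lt]; constructor <;> linarith)
  have h4 : Complex.exp ((θ - π : ℝ) * Complex.I) = -Complex.exp (θ * Complex.I) := by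
    rw [Complex.ofReal_sub, sub_mul, Complex.exp_sub, Complex.exp_pi_mul_I]
    ring
  simp only [h4, mul_neg, neg_neg] at h
  have hre : ∀ t : ℝ, (((t ^ (z - 1) : ℝ) : ℂ) * Complex.exp (t * Complex.exp (θ * Complex.I))).im
      = t ^ (z - 1) * (exp (t * cos θ) * sin (t * sin θ)) := by
    intro t
    rw [Complex.im_ofReal_mul, Complex.exp_im, Complex.re_ofReal_mul, Complex.im_ofReal_mul,
      Complex.exp_ofReal_mul_I_re, Complex.exp_ofReal_mul_I_im]
  have hi : IntegrableOn (fun t : ℝ => ((t ^ (z - 1) : ℝ) : ℂ) *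
      Complex.exp (t * Complex.exp (θ * Complex.I))) (Ioi 0) := by
    have := integrableOn_rpow_mul_exp_neg_mul_rpow (s := z - 1) (p := 1) (b := -cos θ)
      (by linarith) one_pos (by linarith)
    refine this.mono' (Measurable.aestronglyMeasurable (by fun_prop)) ?_
    filter_upwards [ae_restrict_mem measurableSet_Ioi] with t (ht : 0 < t)
    rw [norm_mul, Complex.norm_real, norm_of_nonneg (by positivity), Complex.norm_exp,
      Complex.re_ofReal_mul, Complex.exp_ofReal_mul_I_re, rpow_one]
    ring_nf
    exact le_rfl
  have him := integral_im hi
  have hi' := hi.im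
  simp only [RCLike.im_to_complex, hre] at him hi'
  refine ⟨hi', ?_⟩
  rw [him, h, Complex.im_ofReal_mul, show -(z * ((θ - π : ℝ) * Complex.I) : ℂ)
    = (((π - θ) * z : ℝ) : ℂ) * Complex.I by push_cast; ring, Complex.exp_ofReal_mul_I_im]

theorem integral_rpow_mul_hittingKernel {α z : ℝ} (hα : α ∈ Ioo (1 : ℝ) 2) (hz1 : 1 < z)
    (hz2 : z < 1 + α) :
    ∫ t in Ioi (0 : ℝ), t ^ (z - 1) * hittingKernel α t = Gamma z / π *
      (sin (π / α) * sin (π * z) / sin (π * (1 - z) / α) - sin ((π - π / α) * z)) := by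
  obtain ⟨h1, h2, hcos, hsin⟩ := half_pi_lt_pi_div hα
  have hα0 : 0 < α := by linarith [hα.1]
  obtain ⟨hi, hI⟩ := integral_rpow_mul_exp_cos_mul_sin (z := z) (by linarith) h1 h2
  have hG := integrableOn_rpow_mul_hittingKernel hα (by linarith [hα.1]) hz2
  have hF : IntegrableOn (fun t => t ^ (z - 1) * mittagLefflerKernel α t) (Ioi 0) := by
    refine ((hG.add (hi.const_mul (1 / π))).const_mul (α * sin (π / α) / π)⁻¹).congr
      (Eventually.of_forall fun t => ?_)
    have : α * sin (π / α) / π ≠ 0 := by positivity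
    simp only [Pi.add_apply, hittingKernel]
    field_simp
    ring
  have h3 : ∀ t, t ^ (z - 1) * hittingKernel α t =
      α * sin (π / α) / π * (t ^ (z - 1) * mittagLefflerKernel α t) -
      1 / π * (t ^ (z - 1) * (exp (t * cos (π / α)) * sin (t * sin (π / α)))) := by
    intro t; rw [hittingKernel]; ring
  simp only [h3]
  rw [integral_sub (hF.const_mul _) (hi.const_mul _), integral_const_mul, integral_const_mul, hI,
    integral_rpow_mul_mittagLefflerKernel hα hz1 hz2]
  field_simp

theorem integral_rpow_mul_hittingKernel_eq_zero {α : ℝ} (hα : α ∈ Ioo (1 : ℝ) 2) :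
    ∫ t in Ioi (0 : ℝ), t ^ (α - 1) * hittingKernel α t = 0 := by
  obtain ⟨h1, h2, hcos, hsin⟩ := half_pi_lt_pi_div hα
  have hα0 : 0 < α := by linarith [hα.1]
  rw [integral_rpow_mul_hittingKernel hα hα.1 (by linarith),
    show π * (1 - α) / α = π / α - π by field_simp, sin_sub_pi,
    show (π - π / α) * α = π * α - π by field_simp, sin_sub_pi]
  field_simp
  ring

theorem exp_neg_mul_rpow_mul_le {α x : ℝ} (hα : α ∈ Ioo (1 : ℝ) 2) (hx : 0 < x) :
    ∃ C : ℝ, 0 < C ∧ ∀ t : ℝ, 0 < t →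
      exp (-(x * t ^ α)) * (α * t ^ (α - 1)) ≤ C * exp (-(2 * t)) := by
  have hα0 : 0 < α := by linarith [hα.1]
  have hα1 : 0 < α - 1 := by linarith [hα.1]
  set T : ℝ := (3 / x) ^ (1 / (α - 1)) with hT
  have hT0 : 0 < T := by positivity
  refine ⟨α * exp (3 * T), by positivity, fun t ht => ?_⟩
  have h1 : t ^ (α - 1) ≤ exp t := by
    calc t ^ (α - 1) ≤ (1 + t) ^ (α - 1) := rpow_le_rpow ht.le (by linarith) hα1.le
      _ ≤ (1 + t) ^ (1 : ℝ) := rpow_le_rpow_of_exponent_le (by linarith) (by linarith [hα.2])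
      _ = t + 1 := by rw [rpow_one, add_comm]
      _ ≤ exp t := add_one_le_exp t
  have h2 : 3 * t - 3 * T ≤ x * t ^ α := by
    rcases le_total t T with h | h
    · have : 0 < x * t ^ α := by positivity
      linarith
    · have h3 : 3 / x ≤ t ^ (α - 1) := by
        calc 3 / x = T ^ (α - 1) := by
              rw [hT, ← rpow_mul (by positivity), one_div_mul_cancel hα1.ne', rpow_one]
          _ ≤ _ := rpow_le_rpow hT0.le h hα1.le
      rw [div_le_iff₀ hx] at h3
      have h4 : t ^ α = t ^ (α - 1) * t := by
        rw [← rpow_add_one ht.ne']; ring_nf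
      rw [h4]
      nlinarith
  calc exp (-(x * t ^ α)) * (α * t ^ (α - 1)) ≤ exp (-(3 * t - 3 * T)) * (α * exp t) := by
        gcongr
    _ = _ := by
      rw [mul_left_comm, mul_assoc, ← exp_add, ← exp_add]; ring_nf

theorem integral_exp_neg_mul_rpow_mul {α x a : ℝ} (hα : 0 < α) (hx : 0 < x) (ha : 1 ≤ a) :
    ∫ t in Ioi (0 : ℝ), exp (-(x * t ^ α)) * (α * t ^ (α - 1)) * (t ^ (a - 1) / Gamma a)
      = x ^ (-((a + α - 1) / α)) * Gamma ((a + α - 1) / α) / Gamma a := by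
  have h := integral_rpow_mul_exp_neg_mul_rpow (p := α) (q := a + α - 2) (b := x) hα
    (by linarith) hx
  have h1 : ∀ t ∈ Ioi (0 : ℝ), exp (-(x * t ^ α)) * (α * t ^ (α - 1)) * (t ^ (a - 1) / Gamma a)
      = α / Gamma a * (t ^ (a + α - 2) * exp (-x * t ^ α)) := by
    intro t (ht : 0 < t)
    rw [show a + α - 2 = (α - 1) + (a - 1) by ring, rpow_add ht, neg_mul]
    ring
  rw [setIntegral_congr_fun measurableSet_Ioi h1, integral_const_mul, h,
    show a + α - 2 + 1 = a + α - 1 by ring, neg_div]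
  field_simp

theorem hasSum_integral_exp_neg_mul_rpow {α x M : ℝ} {a c : ℕ → ℝ} (hα : α ∈ Ioo (1 : ℝ) 2)
    (hx : 0 < x) (ha : ∀ n : ℕ, (n : ℝ) + 1 ≤ a n)
    (hc : ∀ n : ℕ, |c n| ≤ M) :
    HasSum (fun n => c n * (x ^ (-((a n + α - 1) / α)) * Gamma ((a n + α - 1) / α) / Gamma (a n)))
      (∫ t in Ioi (0 : ℝ), exp (-(x * t ^ α)) * (α * t ^ (α - 1)) *
        ∑' n, c n * (t ^ (a n - 1) / Gamma (a n))) := by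
  have hα0 : 0 < α := by linarith [hα.1]
  have hM : 0 ≤ M := (abs_nonneg _).trans (hc 0)
  obtain ⟨C, hC, hw⟩ := exp_neg_mul_rpow_mul_le hα hx
  have ha1 : ∀ n, 1 ≤ a n := fun n => by have := ha n; have := n.cast_nonneg (α := ℝ); linarith
  have hG : ∀ n, 0 < Gamma (a n) := fun n => Gamma_pos_of_pos (by linarith [ha1 n])
  set u : ℕ → ℝ → ℝ := fun n t => exp (-(x * t ^ α)) * (α * t ^ (α - 1)) *
    (c n * (t ^ (a n - 1) / Gamma (a n))) with hu
  have hbound : ∀ n, ∀ t ∈ Ioi (0 : ℝ),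
      ‖u n t‖ ≤ C * M * (t ^ (a n - 1) / Gamma (a n) * exp (-(2 * t))) := by
    intro n t (ht : 0 < t)
    have := hG n
    rw [hu]
    simp only
    rw [norm_mul, norm_mul (c n), norm_of_nonneg (by positivity), norm_eq_abs (c n),
      norm_of_nonneg (by positivity)]
    calc _ ≤ C * exp (-(2 * t)) * (M * (t ^ (a n - 1) / Gamma (a n))) := by
          refine mul_le_mul (hw t ht) (mul_le_mul_of_nonneg_right (hc n) ?_) ?_ ?_ <;> positivity
      _ = _ := by ring
  have hexp : ∀ n, IntegrableOn (fun t : ℝ => C * M * (t ^ (a n - 1) / Gamma (a n) *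
      exp (-(2 * t)))) (Ioi 0) := fun n =>
    ((integrableOn_rpow_div_Gamma_mul_exp (by linarith [ha1 n])).1).const_mul _
  have hint : ∀ n, IntegrableOn (u n) (Ioi 0) := by
    intro n
    refine (hexp n).mono' (Measurable.aestronglyMeasurable (by rw [hu]; fun_prop)) ?_
    filter_upwards [ae_restrict_mem measurableSet_Ioi] with t ht
    exact hbound n t ht
  have hval : ∀ n, c n * (x ^ (-((a n + α - 1) / α)) * Gamma ((a n + α - 1) / α) / Gamma (a n))
      = ∫ t in Ioi (0 : ℝ), u n t := by
    intro n
    rw [← integral_exp_neg_mul_rpow_mul hα0 hx (ha1 n), ← integral_const_mul]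
    refine integral_congr_ae (Eventually.of_forall fun t => ?_)
    simp only [hu]; ring
  have htsum : (∫ t in Ioi (0 : ℝ), exp (-(x * t ^ α)) * (α * t ^ (α - 1)) *
      ∑' n, c n * (t ^ (a n - 1) / Gamma (a n))) = ∫ t in Ioi (0 : ℝ), ∑' n, u n t := by
    simp only [hu, tsum_mul_left]
  simp only [hval, htsum]
  refine hasSum_integral_of_summable_integral_norm hint ?_
  refine Summable.of_nonneg_of_le (f := fun n : ℕ => C * M * (1 / 2) ^ n)
    (fun n => by positivity) (fun n => ?_) (summable_geometric_two.mul_left _)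
  calc ∫ t in Ioi (0 : ℝ), ‖u n t‖
        ≤ ∫ t in Ioi (0 : ℝ), C * M * (t ^ (a n - 1) / Gamma (a n) * exp (-(2 * t))) :=
          setIntegral_mono_on (hint n).norm (hexp n) measurableSet_Ioi (hbound n)
      _ = C * M * (1 / 2) ^ (a n) := by
          rw [integral_const_mul, (integrableOn_rpow_div_Gamma_mul_exp (by linarith [ha1 n])).2]
      _ ≤ C * M * (1 / 2) ^ n := by
          gcongr
          rw [← rpow_natCast (1 / 2)]
          exact rpow_le_rpow_of_exponent_ge (by norm_num) (by norm_num) (by linarith [ha n])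

theorem Gamma_neg_inv (u : ℝ) (hu : 0 < u) :
    (Gamma (-u))⁻¹ = -(Gamma (1 + u) * sin (π * u) / π) := by
  have h := Gamma_mul_Gamma_one_sub (-u)
  rw [sub_neg_eq_add, mul_neg, sin_neg, div_neg] at h
  have hG := (Gamma_pos_of_pos (show 0 < 1 + u by linarith)).ne'
  have hπ := pi_pos.ne'
  by_cases hs : sin (π * u) = 0
  · rw [hs, div_zero, neg_zero] at h
    rw [hs, (mul_eq_zero.1 h).resolve_right hG]
    simp
  · have h2 : Gamma (-u) = -(π / sin (π * u)) / Gamma (1 + u) := by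
      rw [eq_div_iff hG, h]
    rw [h2, inv_div]
    field_simp

theorem tsum_sin_mul_pow_div (t θ : ℝ) :
    ∑' n : ℕ, sin (((n : ℝ) + 1) * θ) * (t ^ ((n : ℝ) + 2 - 1) / Gamma ((n : ℝ) + 2))
      = exp (t * cos θ) * sin (t * sin θ) := by
  have h := NormedSpace.expSeries_div_hasSum_exp (t * Complex.exp (θ * Complex.I))
  rw [← Complex.exp_eq_exp_ℂ] at h
  have h2 := Complex.hasSum_im h
  have h3 : ∀ n : ℕ, ((t * Complex.exp (θ * Complex.I)) ^ n / (n.factorial : ℂ)).im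
      = sin (n * θ) * (t ^ n / n.factorial) := by
    intro n
    rw [mul_pow, ← Complex.exp_nat_mul, show (n : ℂ) * (θ * Complex.I) = ((n * θ : ℝ) : ℂ) *
      Complex.I by push_cast; ring, mul_div_right_comm, show (t : ℂ) ^ n / (n.factorial : ℂ)
      = ((t ^ n / n.factorial : ℝ) : ℂ) by push_cast; ring, Complex.im_ofReal_mul,
      Complex.exp_ofReal_mul_I_im, mul_comm]
  have h4 : (Complex.exp (t * Complex.exp (θ * Complex.I))).im
      = exp (t * cos θ) * sin (t * sin θ) := by
    rw [Complex.exp_im, Complex.re_ofReal_mul, Complex.im_ofReal_mul,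
      Complex.exp_ofReal_mul_I_re, Complex.exp_ofReal_mul_I_im]
  simp only [h3, h4] at h2
  rw [← h2.tsum_eq, h2.summable.tsum_eq_zero_add]
  simp only [Nat.cast_zero, zero_mul, sin_zero, zero_add]
  refine tsum_congr fun n => ?_
  rw [show (n : ℝ) + 2 - 1 = ((n + 1 : ℕ) : ℝ) by push_cast; ring, rpow_natCast,
    show (n : ℝ) + 2 = ((n + 1 : ℕ) : ℝ) + 1 by push_cast; ring, Gamma_nat_eq_factorial]
  push_cast
  rfl

theorem integrableOn_exp_neg_mul_rpow_mul {α x : ℝ} (hα : α ∈ Ioo (1 : ℝ) 2) (hx : 0 < x)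
    {f : ℝ → ℝ} (hf : IntegrableOn (fun t => exp (-(2 * t)) * f t) (Ioi 0))
    (hfm : AEStronglyMeasurable f (volume.restrict (Ioi 0))) :
    IntegrableOn (fun t => exp (-(x * t ^ α)) * (α * t ^ (α - 1)) * f t) (Ioi 0) := by
  have hα0 : 0 < α := by linarith [hα.1]
  obtain ⟨C, hC, hw⟩ := exp_neg_mul_rpow_mul_le hα hx
  refine (hf.norm.const_mul C).mono'
    (AEStronglyMeasurable.mul (Measurable.aestronglyMeasurable (by fun_prop)) hfm) ?_
  filter_upwards [ae_restrict_mem measurableSet_Ioi] with t (ht : 0 < t)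
  rw [norm_mul, norm_of_nonneg (by positivity), norm_mul, norm_of_nonneg (exp_pos _).le,
    ← mul_assoc C]
  exact mul_le_mul_of_nonneg_right (hw t ht) (norm_nonneg (f t))

/-- The hitting density is a generalised Laplace transform of the kernel. -/
theorem hittingDensity_eq_integral {α x : ℝ} (hα : α ∈ Ioo (1 : ℝ) 2) (hx : 0 < x) :
    hittingDensity α x
      = ∫ t in Ioi (0 : ℝ), exp (-(x * t ^ α)) * (α * t ^ (α - 1)) * hittingKernel α t := by
  have hα0 : 0 < α := by linarith [hα.1]
  have hinv : 1 / α < 1 := by rw [div_lt_one hα0]; exact hα.1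
  have hπ := pi_pos.ne'
  have h1 := (hasSum_integral_exp_neg_mul_rpow (M := 1) (a := fun n => α * ((n : ℝ) + 1))
    (c := fun n => (-1) ^ n) hα hx
    (fun n => by nlinarith [hα.1, n.cast_nonneg (α := ℝ)]) (fun n => by simp)).tsum_eq
  have h2 := (hasSum_integral_exp_neg_mul_rpow (M := 1) (a := fun n => (n : ℝ) + 2)
    (c := fun n => sin (((n : ℝ) + 1) * (π / α))) hα hx
    (fun n => by linarith) (fun n => abs_sin_le_one _)).tsum_eq
  have hi1 := integrableOn_exp_neg_mul_rpow_mul hα hx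
    (integrableOn_exp_mul_mittagLefflerKernel hα.1)
    ((continuousOn_mittagLefflerKernel hα.1).aestronglyMeasurable measurableSet_Ioi)
  have hi2 : IntegrableOn (fun t => exp (-(x * t ^ α)) * (α * t ^ (α - 1)) *
      (exp (t * cos (π / α)) * sin (t * sin (π / α)))) (Ioi 0) := by
    refine integrableOn_exp_neg_mul_rpow_mul hα hx ?_
      (Continuous.aestronglyMeasurable (by fun_prop))
    refine (integrableOn_exp_neg_Ioi 0).mono' (Continuous.aestronglyMeasurable (by fun_prop)) ?_
    filter_upwards [ae_restrict_mem measurableSet_Ioi] with t (ht : 0 < t)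
    have h5 : exp (t * cos (π / α)) ≤ exp t := exp_le_exp.2 (by nlinarith [cos_le_one (π / α)])
    rw [norm_mul, norm_mul, norm_of_nonneg (exp_pos _).le, norm_of_nonneg (exp_pos _).le,
      norm_eq_abs]
    calc _ ≤ exp (-(2 * t)) * (exp t * 1) := by
          gcongr
          exact abs_sin_le_one _
      _ = exp (-t) := by rw [mul_one, ← exp_add]; ring_nf
  have h3 : ∀ t, exp (-(x * t ^ α)) * (α * t ^ (α - 1)) * hittingKernel α t
      = α * sin (π / α) / π * (exp (-(x * t ^ α)) * (α * t ^ (α - 1)) * mittagLefflerKernel α t)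
        - 1 / π * (exp (-(x * t ^ α)) * (α * t ^ (α - 1)) *
          (exp (t * cos (π / α)) * sin (t * sin (π / α)))) := by
    intro t
    rw [hittingKernel]; ring
  simp only [h3]
  rw [integral_sub (hi1.const_mul _) (hi2.const_mul _), integral_const_mul, integral_const_mul]
  simp only [tsum_sin_mul_pow_div] at h2
  have h1' : (∫ t in Ioi (0 : ℝ), exp (-(x * t ^ α)) * (α * t ^ (α - 1)) *
      mittagLefflerKernel α t) = _ := h1.symm
  rw [h1', ← h2, ← tsum_mul_left, ← tsum_mul_left, sub_eq_add_neg, ← tsum_neg, hittingDensity]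
  congr 1
  · refine tsum_congr fun n => ?_
    have hn := n.cast_nonneg (α := ℝ)
    have hu : 0 < (n : ℝ) + 1 - 1 / α := by linarith
    have hg := Gamma_neg_inv _ hu
    have hs : sin (π * ((n : ℝ) + 1 - 1 / α)) = (-1) ^ n * sin (π / α) := by
      have := sin_nat_mul_pi_sub (π / α) (n + 1)
      rw [show π * ((n : ℝ) + 1 - 1 / α) = ((n + 1 : ℕ) : ℝ) * π - π / α by push_cast; ring, this]
      ring
    rw [hs] at hg
    have he : (α * ((n : ℝ) + 1) + α - 1) / α = 1 + ((n : ℝ) + 1 - 1 / α) := by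
      field_simp; ring
    simp only [he]
    rw [show 1 / α - ((n : ℝ) + 1) = -((n : ℝ) + 1 - 1 / α) by ring, div_eq_mul_inv, mul_inv, hg,
      show -((n : ℝ) + 1 - 1 / α) - 1 = -(1 + ((n : ℝ) + 1 - 1 / α)) by ring]
    ring
  · refine tsum_congr fun n => ?_
    have hu : 0 < ((n : ℝ) + 1) / α := by positivity
    have hg := Gamma_neg_inv _ hu
    have he : ((n : ℝ) + 2 + α - 1) / α = 1 + ((n : ℝ) + 1) / α := by
      field_simp; ring
    have hf : Gamma ((n : ℝ) + 2) = ((n + 1).factorial : ℝ) := by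
      rw [← Gamma_nat_eq_factorial]; push_cast; ring_nf
    simp only [he, hf]
    rw [neg_div, div_eq_mul_inv, mul_inv, hg,
      show -(((n : ℝ) + 1) / α) - 1 = -(1 + ((n : ℝ) + 1) / α) by ring,
      show π * (((n : ℝ) + 1) / α) = ((n : ℝ) + 1) * (π / α) by ring]
    ring

theorem abs_integral_mul_hittingKernel_le {α β K : ℝ} {w : ℝ → ℝ} (hα : α ∈ Ioo (1 : ℝ) 2)
    (hβ1 : 1 - α < α + α * β) (hβ2 : β * α < 1) (hw : ∀ y, 0 < y → |w y| ≤ K * y ^ β) :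
    ∃ C : ℝ, ∀ x : ℝ, 0 < x →
      |∫ t in Ioi (0 : ℝ), w (x * t ^ α) * (α * t ^ (α - 1)) * hittingKernel α t|
        ≤ C * x ^ β := by
  have hα0 : 0 < α := by linarith [hα.1]
  have hi := (integrableOn_rpow_mul_hittingKernel hα hβ1 (by linarith)).norm
  refine ⟨K * α * ∫ t in Ioi (0 : ℝ), ‖t ^ (α + α * β - 1) * hittingKernel α t‖,
    fun x hx => ?_⟩
  rw [mul_right_comm, ← integral_const_mul, ← norm_eq_abs]
  refine norm_integral_le_of_norm_le (hi.const_mul _) ?_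
  filter_upwards [ae_restrict_mem measurableSet_Ioi] with t (ht : 0 < t)
  rw [norm_mul, norm_mul, norm_of_nonneg (by positivity : 0 ≤ α * t ^ (α - 1)), norm_mul,
    norm_of_nonneg (by positivity : 0 ≤ t ^ (α + α * β - 1)), norm_eq_abs]
  calc _ ≤ K * (x * t ^ α) ^ β * (α * t ^ (α - 1)) * ‖hittingKernel α t‖ := by
        gcongr
        exact hw _ (by positivity)
    _ = _ := by
      rw [mul_rpow hx.le (by positivity), ← rpow_mul ht.le,
        show α + α * β - 1 = α * β + (α - 1) by ring, rpow_add ht]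
      ring

theorem integrableOn_bounded_mul_hittingKernel {α : ℝ} {w : ℝ → ℝ} (hα : α ∈ Ioo (1 : ℝ) 2)
    (hwm : Measurable w) (hw : ∀ t, 0 < t → |w t| ≤ 1) :
    IntegrableOn (fun t => w t * (α * t ^ (α - 1)) * hittingKernel α t) (Ioi 0) := by
  have h := (integrableOn_rpow_mul_hittingKernel hα (z := α) (by linarith [hα.1])
    (by linarith)).const_mul α
  have h2 : IntegrableOn (fun t => w t * (α * (t ^ (α - 1) * hittingKernel α t))) (Ioi 0) := by
    refine h.bdd_mul (c := 1) hwm.aestronglyMeasurable ?_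
    filter_upwards [ae_restrict_mem measurableSet_Ioi] with t ht
    exact hw t ht
  simpa only [mul_assoc] using h2

theorem continuousOn_hittingDensity {α : ℝ} (hα : α ∈ Ioo (1 : ℝ) 2) :
    ContinuousOn (hittingDensity α) (Ioi 0) := by
  have hα0 : 0 < α := by linarith [hα.1]
  refine ContinuousOn.congr ?_ (fun x hx => hittingDensity_eq_integral hα hx)
  have hexp : ∀ x : ℝ, 0 < x → ∀ t : ℝ, 0 < t → |exp (-(x * t ^ α))| ≤ 1 := fun x hx t ht => by
    rw [abs_of_pos (exp_pos _), exp_le_one_iff, neg_nonpos]; positivity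
  refine continuousOn_of_dominated
    (bound := fun t => ‖1 * (α * t ^ (α - 1)) * hittingKernel α t‖)
    (fun x hx => ?_) (fun x hx => ?_) ?_ ?_
  · exact (integrableOn_bounded_mul_hittingKernel hα (by fun_prop)
      (hexp x hx)).aestronglyMeasurable
  · filter_upwards [ae_restrict_mem measurableSet_Ioi] with t ht
    simp only [norm_mul, norm_one]
    gcongr
    exact hexp x hx t ht
  · exact (integrableOn_bounded_mul_hittingKernel hα (w := fun _ => 1) (by fun_prop)
      (by simp)).norm
  · exact Eventually.of_forall fun t => Continuous.continuousOn (by fun_prop)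

theorem abs_hittingDensity_le_rpow_neg {α θ : ℝ} (hα : α ∈ Ioo (1 : ℝ) 2) (hθ : 0 < θ)
    (hθ2 : θ < 2 - 1 / α) :
    ∃ C : ℝ, ∀ x : ℝ, 0 < x → |hittingDensity α x| ≤ C * x ^ (-θ) := by
  have hα0 : 0 < α := by linarith [hα.1]
  have h1 : α * θ < 2 * α - 1 := by
    calc α * θ < α * (2 - 1 / α) := by gcongr
      _ = _ := by field_simp
  obtain ⟨C, hC⟩ := abs_integral_mul_hittingKernel_le (w := fun y => exp (-y)) (β := -θ)
    (K := θ ^ θ) hα (by linarith) (by nlinarith) (fun y hy => by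
      rw [abs_of_pos (exp_pos _)]; exact exp_neg_le_mul_rpow_neg hθ hy)
  exact ⟨C, fun x hx => by rw [hittingDensity_eq_integral hα hx]; exact hC x hx⟩

theorem abs_hittingDensity_le_rpow {α θ : ℝ} (hα : α ∈ Ioo (1 : ℝ) 2) (hθ : 0 < θ)
    (hθ2 : θ < 1 / α) :
    ∃ C : ℝ, ∀ x : ℝ, 0 < x → |hittingDensity α x| ≤ C * x ^ θ := by
  have hα0 : 0 < α := by linarith [hα.1]
  have h1 : θ * α < 1 := by rwa [lt_div_iff₀ hα0] at hθ2
  have hθ1 : θ ≤ 1 := by nlinarith [hα.1]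
  have hexp : ∀ y, 0 < y → |exp (-y) - 1| ≤ 1 * y ^ θ := fun y hy => by
    have h2 : exp (-y) ≤ 1 := by rw [exp_le_one_iff]; linarith
    rw [abs_of_nonpos (by linarith), one_mul]
    rcases le_total y 1 with h | h
    · calc -(exp (-y) - 1) ≤ y := by linarith [add_one_le_exp (-y)]
        _ = y ^ (1 : ℝ) := (rpow_one y).symm
        _ ≤ y ^ θ := rpow_le_rpow_of_exponent_ge hy h hθ1
    · linarith [one_le_rpow h hθ.le, exp_pos (-y)]
  obtain ⟨C, hC⟩ := abs_integral_mul_hittingKernel_le (w := fun y => exp (-y) - 1)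
    (K := 1) hα (by nlinarith [hα.1]) h1 hexp
  refine ⟨C, fun x hx => ?_⟩
  have h0 : (∫ t in Ioi (0 : ℝ), 1 * (α * t ^ (α - 1)) * hittingKernel α t) = 0 := by
    simp only [one_mul, mul_assoc]
    rw [integral_const_mul, integral_rpow_mul_hittingKernel_eq_zero hα, mul_zero]
  have hsub := integral_sub
    (integrableOn_bounded_mul_hittingKernel hα (w := fun t => exp (-(x * t ^ α)))
      (by fun_prop) fun t ht => by
        rw [abs_of_pos (exp_pos _), exp_le_one_iff, neg_nonpos]; positivity)
    (integrableOn_bounded_mul_hittingKernel hα (w := fun _ => 1) (by fun_prop) (by simp))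
  rw [h0, sub_zero] at hsub
  rw [hittingDensity_eq_integral hα hx, ← hsub]
  simpa only [sub_mul] using hC x hx

theorem differentiableAt_mellin_hittingDensity {α : ℝ} {s : ℂ} (hα : α ∈ Ioo (1 : ℝ) 2)
    (hs1 : -(1 / α) < s.re) (hs2 : s.re < 2 - 1 / α) :
    DifferentiableAt ℂ (mellin fun x => (hittingDensity α x : ℂ)) s := by
  have hα0 : 0 < α := by linarith [hα.1]
  have hinv : 1 / α < 1 := by rw [div_lt_one hα0]; exact hα.1
  have hinv0 : 0 < 1 / α := by positivity
  obtain ⟨a, ha1, ha2⟩ := exists_between (max_lt hs2 (by linarith : 0 < 2 - 1 / α))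
  obtain ⟨b, hb1, hb2⟩ := exists_between (lt_min hs1 (by linarith : -(1 / α) < 0))
  rw [max_lt_iff] at ha1
  rw [lt_min_iff] at hb2
  obtain ⟨C, hC⟩ := abs_hittingDensity_le_rpow_neg hα ha1.2 ha2
  obtain ⟨D, hD⟩ := abs_hittingDensity_le_rpow hα (θ := -b) (by linarith) (by linarith)
  refine mellin_differentiableAt_of_isBigO_rpow (a := a) (b := b) ?_ ?_ ha1.1 ?_ hb2.1
  · exact (Complex.continuous_ofReal.comp_continuousOn
      (continuousOn_hittingDensity hα)).locallyIntegrableOn measurableSet_Ioi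
  · refine Asymptotics.IsBigO.of_bound C ?_
    filter_upwards [eventually_gt_atTop 0] with x hx
    rw [Complex.norm_real, norm_of_nonneg (by positivity : 0 ≤ x ^ (-a))]
    exact hC x hx
  · refine Asymptotics.IsBigO.of_bound D ?_
    filter_upwards [self_mem_nhdsWithin] with x (hx : 0 < x)
    rw [Complex.norm_real, norm_of_nonneg (by positivity : 0 ≤ x ^ (-b))]
    exact hD x hx

/-- On part of the strip the moment can be computed by exchanging the order of integration. -/
theorem integral_rpow_mul_hittingDensity_eq_integral_hittingKernel {α s : ℝ}
    (hα : α ∈ Ioo (1 : ℝ) 2) (hs1 : -1 < s) (hs2 : s < -(1 / α)) :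
    ∫ x in Ioi (0 : ℝ), x ^ s * hittingDensity α x
      = α * Gamma (s + 1) * ∫ t in Ioi (0 : ℝ), t ^ (-(α * s) - 1) * hittingKernel α t := by
  have hα0 : 0 < α := by linarith [hα.1]
  have hz : 1 < -(α * s) := by
    have := (mul_lt_mul_iff_right₀ hα0).2 hs2
    rw [mul_neg, mul_one_div_cancel hα0.ne'] at this
    linarith
  have hz2 : -(α * s) < 1 + α := by nlinarith
  have hG := integrableOn_rpow_mul_hittingKernel hα (z := -(α * s)) (by linarith) hz2
  set f : ℝ → ℝ → ℝ := fun x t =>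
    x ^ s * exp (-(t ^ α * x)) * (α * t ^ (α - 1) * hittingKernel α t) with hf
  have hinner : ∀ t, 0 < t → ∫ x in Ioi (0 : ℝ), x ^ s * exp (-(t ^ α * x))
      = Gamma (s + 1) * t ^ (-(α * (s + 1))) := by
    intro t ht
    have := integral_rpow_mul_exp_neg_mul_Ioi (a := s + 1) (r := t ^ α) (by linarith)
      (by positivity)
    rw [add_sub_cancel_right] at this
    rw [this, one_div, ← rpow_neg ht.le, ← rpow_mul ht.le]
    ring_nf
  have hinner_int : ∀ t, 0 < t → IntegrableOn (fun x => x ^ s * exp (-(t ^ α * x))) (Ioi 0) := by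
    intro t ht
    have := integrableOn_rpow_mul_exp_neg_mul_rpow (p := 1) (s := s) (b := t ^ α) hs1 one_pos
      (by positivity)
    simpa only [rpow_one, neg_mul] using this
  have hpow : ∀ t, 0 < t → t ^ (-(α * (s + 1))) * (α * t ^ (α - 1) * hittingKernel α t)
      = α * (t ^ (-(α * s) - 1) * hittingKernel α t) := by
    intro t ht
    rw [show -(α * s) - 1 = -(α * (s + 1)) + (α - 1) by ring, rpow_add ht]
    ring
  have hmeas : AEStronglyMeasurable (Function.uncurry f)
      ((volume.restrict (Ioi 0)).prod (volume.restrict (Ioi 0))) := by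
    have hk : AEStronglyMeasurable (fun t => α * t ^ (α - 1) * hittingKernel α t)
        (volume.restrict (Ioi (0 : ℝ))) :=
      AEStronglyMeasurable.mul (Measurable.aestronglyMeasurable (by fun_prop))
        ((continuousOn_hittingKernel hα.1).aestronglyMeasurable measurableSet_Ioi)
    refine AEStronglyMeasurable.mul (Measurable.aestronglyMeasurable ?_) hk.comp_snd
    fun_prop
  have hint : Integrable (Function.uncurry f)
      ((volume.restrict (Ioi 0)).prod (volume.restrict (Ioi 0))) := by
    rw [integrable_prod_iff' hmeas]
    constructor
    · filter_upwards [ae_restrict_mem measurableSet_Ioi] with t ht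
      exact (hinner_int t ht).mul_const (α * t ^ (α - 1) * hittingKernel α t)
    · refine ((hG.norm.const_mul (Gamma (s + 1) * α))).congr ?_
      filter_upwards [ae_restrict_mem measurableSet_Ioi] with t (ht : 0 < t)
      have h1 : ∀ x ∈ Ioi (0 : ℝ), ‖Function.uncurry f (x, t)‖
          = x ^ s * exp (-(t ^ α * x)) * ‖α * t ^ (α - 1) * hittingKernel α t‖ := by
        intro x (hx : 0 < x)
        simp only [hf, Function.uncurry_apply_pair]
        rw [norm_mul, norm_of_nonneg (by positivity)]
      rw [setIntegral_congr_fun measurableSet_Ioi h1, integral_mul_const, hinner t ht, mul_assoc,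
        mul_assoc]
      congr 1
      rw [← norm_of_nonneg (by positivity : 0 ≤ t ^ (-(α * (s + 1)))), ← norm_mul, hpow t ht,
        norm_mul α, norm_of_nonneg hα0.le]
  have h1 : ∀ x ∈ Ioi (0 : ℝ), x ^ s * hittingDensity α x = ∫ t in Ioi (0 : ℝ), f x t := by
    intro x (hx : 0 < x)
    rw [hittingDensity_eq_integral hα hx, ← integral_const_mul]
    refine integral_congr_ae (Eventually.of_forall fun t => ?_)
    simp only [hf, mul_comm x]; ring
  rw [setIntegral_congr_fun measurableSet_Ioi h1, integral_integral_swap hint,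
    ← integral_const_mul]
  refine setIntegral_congr_fun measurableSet_Ioi fun t (ht : 0 < t) => ?_
  simp only [hf]
  rw [integral_mul_const, hinner t ht, mul_assoc, hpow t ht]
  ring

theorem integral_rpow_mul_hittingDensity_of_lt {α s : ℝ} (hα : α ∈ Ioo (1 : ℝ) 2)
    (hs1 : -1 < s) (hs2 : s < -(1 / α)) :
    ∫ x in Ioi (0 : ℝ), x ^ s * hittingDensity α x
      = Gamma (1 - α * s) * sin (π * (α - 1) * (s + 1 / α)) /
          (Gamma (1 - s) * sin (π * (s + 1 / α))) := by
  have hα0 : 0 < α := by linarith [hα.1]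
  have hinv : 1 / α < 1 := by rw [div_lt_one hα0]; exact hα.1
  have hinv0 : 0 < 1 / α := by positivity
  have hz : 1 < -(α * s) := by
    have := (mul_lt_mul_iff_right₀ hα0).2 hs2
    rw [mul_neg, mul_one_div_cancel hα0.ne'] at this
    linarith
  have hs0 : s ≠ 0 := by linarith
  have hsin : sin (π * s) ≠ 0 := by
    have := sin_pos_of_pos_of_lt_pi (x := -(π * s)) (by nlinarith [pi_pos]) (by nlinarith [pi_pos])
    rw [sin_neg] at this
    linarith
  have hsinp : sin (π * (s + 1 / α)) ≠ 0 := by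
    have := sin_pos_of_pos_of_lt_pi (x := -(π * (s + 1 / α))) (by nlinarith [pi_pos])
      (by nlinarith [pi_pos])
    rw [sin_neg] at this
    linarith
  rw [integral_rpow_mul_hittingDensity_eq_integral_hittingKernel hα hs1 hs2,
    integral_rpow_mul_hittingKernel hα hz (by nlinarith)]
  have hΓ1 : Gamma (1 - α * s) = -(α * s) * Gamma (-(α * s)) := by
    rw [← Gamma_add_one (by linarith)]; ring_nf
  have hΓ2 : Gamma (s + 1) = s * (π / sin (π * s)) / Gamma (1 - s) := by
    rw [eq_div_iff (Gamma_pos_of_pos (by linarith)).ne', Gamma_add_one hs0, mul_assoc,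
      Gamma_mul_Gamma_one_sub]
  have hT : sin (π * (α - 1) * (s + 1 / α)) = sin (π / α - π * (α * s) + π * s) := by
    rw [← sin_pi_sub]; congr 1; field_simp; ring
  have hp : π * (1 - -(α * s)) / α = π * (s + 1 / α) := by field_simp; ring
  have hA : sin (π * -(α * s)) = -sin (π * (α * s)) := by rw [mul_neg, sin_neg]
  have hAB : sin ((π - π / α) * -(α * s)) = -sin (π * (α * s) - π * s) := by
    rw [← sin_neg]; congr 1; field_simp
  have htrig : sin (π / α) * sin (π * (α * s)) = sin (π * (α * s) - π * s) *
      sin (π * (s + 1 / α)) + sin (π * s) * sin (π / α - π * (α * s) + π * s) := by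
    rw [show π * (s + 1 / α) = π * s + π / α by ring]
    generalize π * (α * s) = A
    generalize π * s = B
    generalize π / α = φ
    rw [sin_sub, sin_add, sin_add, sin_sub, cos_sub]
    linear_combination (-(sin φ * sin A)) * sin_sq_add_cos_sq B
  have hΓ := (Gamma_pos_of_pos (show 0 < 1 - s by linarith)).ne'
  rw [hp, hA, hAB, hT, hΓ1, hΓ2]
  have hπ := pi_pos.ne'
  rw [show sin (π / α) * -sin (π * (α * s)) = -(sin (π / α) * sin (π * (α * s))) by ring, htrig]
  generalize sin (π / α - π * (α * s) + π * s) = T at *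
  generalize sin (π * (α * s) - π * s) = D at *
  generalize sin (π * (s + 1 / α)) = P at *
  generalize sin (π * s) = S at *
  field_simp
  ring

theorem mellin_ofReal_add_one (f : ℝ → ℝ) (s : ℝ) :
    mellin (fun x => (f x : ℂ)) ((s : ℂ) + 1) = ((∫ x in Ioi (0 : ℝ), x ^ s * f x : ℝ) : ℂ) := by
  rw [mellin, show ((∫ x in Ioi (0 : ℝ), x ^ s * f x : ℝ) : ℂ)
    = ∫ x in Ioi (0 : ℝ), ((x ^ s * f x : ℝ) : ℂ) from integral_ofReal.symm]
  refine setIntegral_congr_fun measurableSet_Ioi fun x (hx : 0 < x) => ?_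
  simp only [add_sub_cancel_right, smul_eq_mul]
  rw [Complex.ofReal_mul, Complex.ofReal_cpow hx.le]

theorem mellin_hittingDensity_mul_sin {α : ℝ} (hα : α ∈ Ioo (1 : ℝ) 2) :
    EqOn (fun s : ℂ => mellin (fun x => (hittingDensity α x : ℂ)) (s + 1) *
        Complex.sin (π * (s + 1 / α)))
      (fun s : ℂ => Complex.Gamma (1 - α * s) * Complex.sin (π * (α - 1) * (s + 1 / α)) *
        (Complex.Gamma (1 - s))⁻¹)
      (Complex.re ⁻¹' Ioo (-1 - 1 / α) (1 - 1 / α)) := by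
  have hα0 : 0 < α := by linarith [hα.1]
  have hinv : 1 / α < 1 := by rw [div_lt_one hα0]; exact hα.1
  have hinv0 : 0 < 1 / α := by positivity
  have hopen : IsOpen (Complex.re ⁻¹' Ioo (-1 - 1 / α) (1 - 1 / α)) :=
    isOpen_Ioo.preimage Complex.continuous_re
  have hconn : IsPreconnected (Complex.re ⁻¹' Ioo (-1 - 1 / α) (1 - 1 / α)) :=
    ((convex_Ioo _ _).linear_preimage Complex.reLm).isPreconnected
  obtain ⟨x₀, hx1, hx2⟩ := exists_between (by linarith : (-1 : ℝ) < -(1 / α))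
  refine AnalyticOnNhd.eqOn_of_preconnected_of_frequently_eq (𝕜 := ℂ) (z₀ := (x₀ : ℂ))
    (DifferentiableOn.analyticOnNhd (fun s hs => ?_) hopen)
    (DifferentiableOn.analyticOnNhd (fun s hs => ?_) hopen) hconn ?_ ?_
  · refine DifferentiableAt.differentiableWithinAt (DifferentiableAt.mul ?_ (by fun_prop))
    refine DifferentiableAt.comp (g := mellin _) (f := fun s => s + 1) s
      (differentiableAt_mellin_hittingDensity hα ?_ ?_)
      (by fun_prop)
    · simp only [Complex.add_re, Complex.one_re]; linarith [hs.1]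
    · simp only [Complex.add_re, Complex.one_re]; linarith [hs.2]
  · refine DifferentiableAt.differentiableWithinAt
      (DifferentiableAt.mul (DifferentiableAt.mul ?_ (by fun_prop)) ?_)
    · refine DifferentiableAt.comp s (Complex.differentiableAt_Gamma _ fun m hm => ?_)
        (by fun_prop)
      have h1 := congrArg Complex.re hm
      simp only [Complex.sub_re, Complex.one_re, Complex.re_ofReal_mul, Complex.neg_re,
        Complex.natCast_re] at h1
      have h2 : α * s.re < α * (1 - 1 / α) := by gcongr; exact hs.2
      rw [mul_sub, mul_one_div_cancel hα0.ne'] at h2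
      linarith [hα.2, m.cast_nonneg (α := ℝ)]
    · exact DifferentiableAt.comp (g := fun s => (Complex.Gamma s)⁻¹) (f := fun s => 1 - s) s
        (Complex.differentiable_one_div_Gamma (1 - s)) (by fun_prop)
  · simp only [mem_preimage, Complex.ofReal_re, mem_Ioo]
    constructor <;> linarith
  · have ht : Tendsto (fun x : ℝ => (x : ℂ)) (𝓝[≠] x₀) (𝓝[≠] (x₀ : ℂ)) := by
      refine tendsto_nhdsWithin_of_tendsto_nhds_of_eventually_within _
        (Complex.continuous_ofReal.continuousAt.tendsto.mono_left nhdsWithin_le_nhds) ?_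
      filter_upwards [self_mem_nhdsWithin] with x hx
      simpa using hx
    refine ht.frequently (Eventually.frequently ?_)
    filter_upwards [nhdsWithin_le_nhds (Ioo_mem_nhds hx1 hx2)] with s hs
    have hsinp : sin (π * (s + 1 / α)) ≠ 0 := by
      have := sin_pos_of_pos_of_lt_pi (x := -(π * (s + 1 / α))) (by nlinarith [pi_pos, hs.2])
        (by nlinarith [pi_pos, hs.1])
      rw [sin_neg] at this
      linarith
    have h := integral_rpow_mul_hittingDensity_of_lt hα hs.1 hs.2
    have h2 : (∫ x in Ioi (0 : ℝ), x ^ s * hittingDensity α x) * sin (π * (s + 1 / α))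
        = Gamma (1 - α * s) * sin (π * (α - 1) * (s + 1 / α)) * (Gamma (1 - s))⁻¹ := by
      rw [h, ← div_div, div_mul_cancel₀ _ hsinp, div_eq_mul_inv]
    rw [← Complex.ofReal_inj] at h2
    rw [mellin_ofReal_add_one]
    simpa only [Complex.ofReal_mul, Complex.ofReal_inv, Complex.ofReal_sin, Complex.ofReal_add,
      Complex.ofReal_sub, Complex.ofReal_div, Complex.ofReal_one, ← Complex.Gamma_ofReal] using h2

/-- For every `α ∈ (1,2)` and every real `s` with
`−1 − 1/α < s < 1 − 1/α`, `s ≠ −1/α`, one has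
`∫₀^∞ x^s h_α(x) dx = Γ(1−αs) sin(π(α−1)(s+1/α)) / (Γ(1−s) sin(π(s+1/α)))`. -/
theorem stmt_6 (α s : ℝ) (hα : α ∈ Set.Ioo (1 : ℝ) 2)
    (hs1 : -1 - 1 / α < s) (hs2 : s < 1 - 1 / α) (hs3 : s ≠ -(1 / α)) :
    ∫ x in Set.Ioi (0 : ℝ), x ^ s * hittingDensity α x
      = Real.Gamma (1 - α * s) * Real.sin (π * (α - 1) * (s + 1 / α)) /
          (Real.Gamma (1 - s) * Real.sin (π * (s + 1 / α))) := by
  have hsin : sin (π * (s + 1 / α)) ≠ 0 := by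
    have hp : s + 1 / α ≠ 0 := fun h => hs3 (by linarith)
    rw [Ne, sin_eq_zero_iff_of_lt_of_lt (by nlinarith [pi_pos]) (by nlinarith [pi_pos])]
    exact mul_ne_zero pi_pos.ne' hp
  have h := mellin_hittingDensity_mul_sin hα
    (show (s : ℂ) ∈ Complex.re ⁻¹' Ioo (-1 - 1 / α) (1 - 1 / α) from ⟨hs1, hs2⟩)
  simp only [mellin_ofReal_add_one] at h
  have h2 : (∫ x in Ioi (0 : ℝ), x ^ s * hittingDensity α x) * sin (π * (s + 1 / α))
      = Gamma (1 - α * s) * sin (π * (α - 1) * (s + 1 / α)) * (Gamma (1 - s))⁻¹ := by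
    rw [← Complex.ofReal_inj]
    simpa only [Complex.ofReal_mul, Complex.ofReal_inv, Complex.ofReal_sin, Complex.ofReal_add,
      Complex.ofReal_sub, Complex.ofReal_div, Complex.ofReal_one, ← Complex.Gamma_ofReal] using h
  rw [← div_div, eq_div_iff hsin, h2]
  exact (div_eq_mul_inv _ _).symm
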